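/- arXiv:2206.09778 — 5 statements merged into one kernel-verified Lean document; each statement's English description precedes it below -/
import Mathlib

section
/- Let L/K be a finite Galois extension of fields, n ≥ 1, and let 𝕂_L = L(x_1,…,x_n) be the field of rational functions in n variables over L. Let ρ : Gal(L/K) → GL_n(K) be a group homomorphism, and let Gal(L/K) act on 𝕂_L by field automorphisms via the twisted semilinear action in which σ acts on coefficients through σ and sends the variable x_j to the linear form Σ_i ρ(σ)_{ij} x_i. Then the fixed field of this action is a purely transcendental extension of K of transcendence degree n (i.e., it is K-isomorphic to the rational function field K(x_1,…,x_n)). -/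
/-- Galois descent for `Lⁿ`: the vectors fixed by the semilinear action of `Gal(L/K)` twisted by
a representation over `K` span `Lⁿ`. -/
theorem span_fixed_twisted_eq_top {K L : Type*} [Field K] [Field L] [Algebra K L]
    [FiniteDimensional K L] {n : ℕ} (ρ : (L ≃ₐ[K] L) →* GL (Fin n) K) :
    Submodule.span L {v : Fin n → L | ∀ (σ : L ≃ₐ[K] L) (k : Fin n),
      ∑ i, algebraMap K L (((ρ σ) : Matrix (Fin n) (Fin n) K) k i) * σ (v i) = v k} = ⊤ := by
  classical
  by_contra hne
  obtain ⟨f, hf0, hf⟩ := Submodule.exists_le_ker_of_lt_top _ (lt_top_iff_ne_top.2 hne)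
  apply hf0
  ext1 j
  ext
  set v : Fin n → L := Pi.single j 1
  let T : (L ≃ₐ[K] L) → (Fin n → L) → Fin n → L := fun τ w k =>
    ∑ i, algebraMap K L (((ρ τ) : Matrix (Fin n) (Fin n) K) k i) * τ (w i)
  have hT : ∀ σ τ w, T σ (T τ w) = T (σ * τ) w := by
    intro σ τ w
    ext k
    simp only [T, map_mul, map_sum, Units.val_mul, Matrix.mul_apply, AlgEquiv.commutes,
      AlgEquiv.mul_apply, Finset.mul_sum, Finset.sum_mul]
    rw [Finset.sum_comm]
    simp only [mul_assoc]
  have hTs : ∀ σ (c : L) w, T σ (c • w) = σ c • T σ w := by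
    intro σ c w
    ext k
    simp only [T, Pi.smul_apply, smul_eq_mul, map_mul, Finset.mul_sum]
    exact Finset.sum_congr rfl fun i _ => by ring
  have hTsum : ∀ σ (g : (L ≃ₐ[K] L) → Fin n → L), T σ (∑ τ, g τ) = ∑ τ, T σ (g τ) := by
    intro σ g
    ext k
    simp only [T, Finset.sum_apply, map_sum, Finset.mul_sum]
    rw [Finset.sum_comm]
  have hzero : ∀ c : L, ∑ τ : L ≃ₐ[K] L, f (T τ v) * τ c = 0 := by
    intro c
    have hmem := hf (Submodule.subset_span (s := {v : Fin n → L | ∀ (σ : L ≃ₐ[K] L) (k : Fin n),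
      ∑ i, algebraMap K L (((ρ σ) : Matrix (Fin n) (Fin n) K) k i) * σ (v i) = v k})
      (a := ∑ τ : L ≃ₐ[K] L, T τ (c • v)) (by
        intro σ k
        change T σ (∑ τ, T τ (c • v)) k = _
        rw [hTsum]
        simp only [hT]
        rw [Fintype.sum_equiv (Equiv.mulLeft σ) (fun τ => T (σ * τ) (c • v))
          (fun τ => T τ (c • v)) (fun _ => rfl)]))
    rw [LinearMap.mem_ker, map_sum] at hmem
    simpa [hTs, mul_comm] using hmem
  have hind := Fintype.linearIndependent_iff.1
    ((linearIndependent_monoidHom L L).comp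
      (fun τ : L ≃ₐ[K] L => ((τ : L →+* L) : L →* L))
      (fun σ τ h => AlgEquiv.ext fun x => DFunLike.congr_fun h x))
    (fun τ => f (T τ v)) (by
      ext c
      simpa using hzero c) 1
  have h1 : T 1 v = v := by
    ext k
    simp [T, Matrix.one_apply]
  rw [h1] at hind
  simpa using hind

/-- Hilbert 90 for a cocycle given by a representation over `K`. -/
theorem exists_matrix_twisted_fixed {K L : Type*} [Field K] [Field L] [Algebra K L]
    [FiniteDimensional K L] {n : ℕ} (ρ : (L ≃ₐ[K] L) →* GL (Fin n) K) :
    ∃ A B : Matrix (Fin n) (Fin n) L, A * B = 1 ∧ B * A = 1 ∧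
      ∀ (σ : L ≃ₐ[K] L) (k j : Fin n),
        ∑ i, algebraMap K L (((ρ σ) : Matrix (Fin n) (Fin n) K) k i) * σ (A i j) = A k j := by
  obtain ⟨s, hs, hspan, hli⟩ := exists_linearIndependent L {v : Fin n → L |
    ∀ (σ : L ≃ₐ[K] L) (k : Fin n),
      ∑ i, algebraMap K L (((ρ σ) : Matrix (Fin n) (Fin n) K) k i) * σ (v i) = v k}
  rw [span_fixed_twisted_eq_top] at hspan
  let b₀ := Module.Basis.mk hli (by simp [hspan])
  let b := b₀.reindex (b₀.indexEquiv (Pi.basisFun L (Fin n)))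
  refine ⟨(Pi.basisFun L (Fin n)).toMatrix b, b.toMatrix (Pi.basisFun L (Fin n)),
    Module.Basis.toMatrix_mul_toMatrix_flip _ _, Module.Basis.toMatrix_mul_toMatrix_flip _ _, ?_⟩
  intro σ k j
  have hb : b j ∈ s := by simp [b, b₀]
  simpa [Module.Basis.toMatrix_apply] using hs hb σ k

namespace MvPolynomial

/-- The substitution `Xⱼ ↦ ∑ᵢ Aᵢⱼ Xᵢ`. -/
noncomputable def linearSubst {ι R : Type*} [Fintype ι] [CommRing R] (A : Matrix ι ι R) :
    MvPolynomial ι R →ₐ[R] MvPolynomial ι R :=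
  aeval fun j => ∑ i, C (A i j) * X i

theorem linearSubst_X {ι R : Type*} [Fintype ι] [CommRing R] (A : Matrix ι ι R) (j : ι) :
    linearSubst A (X j) = ∑ i, C (A i j) * X i := by
  simp [linearSubst]

theorem linearSubst_C {ι R : Type*} [Fintype ι] [CommRing R] (A : Matrix ι ι R) (c : R) :
    linearSubst A (C c) = C c := by
  simp [linearSubst]

theorem linearSubst_comp {ι R : Type*} [Fintype ι] [DecidableEq ι] [CommRing R]
    (A B : Matrix ι ι R) (h : A * B = 1) :
    (linearSubst A).comp (linearSubst B) = AlgHom.id R _ := by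
  ext1 j
  have key : ∀ k, ∑ i, C (B i j) * C (A k i) = (C ((A * B) k j) : MvPolynomial ι R) := by
    intro k
    rw [Matrix.mul_apply, map_sum]
    exact Finset.sum_congr rfl fun i _ => by rw [← C_mul, mul_comm]
  simp only [AlgHom.comp_apply, linearSubst_X, map_sum, map_mul, linearSubst_C, Finset.mul_sum]
  rw [Finset.sum_comm]
  simp only [← mul_assoc, ← Finset.sum_mul, key, h]
  simp [Matrix.one_apply]

/-- An invertible linear substitution, as an algebra automorphism. -/
noncomputable def linearSubstEquiv {ι R : Type*} [Fintype ι] [DecidableEq ι] [CommRing R]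
    (A B : Matrix ι ι R) (hAB : A * B = 1) (hBA : B * A = 1) :
    MvPolynomial ι R ≃ₐ[R] MvPolynomial ι R :=
  AlgEquiv.ofAlgHom (linearSubst A) (linearSubst B) (linearSubst_comp A B hAB)
    (linearSubst_comp B A hBA)

/-- A polynomial whose coefficients are Galois invariant is defined over the base field. -/
theorem mem_range_map_of_fixed {ι K L : Type*} [Field K] [Field L] [Algebra K L]
    [FiniteDimensional K L] [IsGalois K L] (p : MvPolynomial ι L)
    (hp : ∀ σ : L ≃ₐ[K] L, map (σ : L →+* L) p = p) :
    ∃ q : MvPolynomial ι K, map (algebraMap K L) q = p := by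
  refine (mem_range_map_iff_coeffs_subset (f := algebraMap K L)).2 ?_
  intro c hc
  obtain ⟨m, -, rfl⟩ := mem_coeffs_iff.1 hc
  refine (IsGalois.mem_range_algebraMap_iff_fixed (F := K) _).2 fun σ => ?_
  conv_rhs => rw [← hp σ, coeff_map]
  rfl

/-- If `Gal(L/K)` acts on a field `F` of fractions of `L[x]` by acting on coefficients, then a
fixed element is a fraction of polynomials over `K`. -/
theorem exists_div_of_fixed {ι K L F : Type*} [Field K] [Field L] [Algebra K L]
    [FiniteDimensional K L] [IsGalois K L] [Field F] [MulSemiringAction (L ≃ₐ[K] L) F]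
    (φ : MvPolynomial ι L →+* F) (hφ : Function.Injective φ)
    (hact : ∀ (σ : L ≃ₐ[K] L) p, σ • φ p = φ (map (σ : L →+* L) p))
    {f : F} {p q : MvPolynomial ι L} (hq : q ≠ 0) (hf : f = φ p / φ q)
    (hfix : ∀ σ : L ≃ₐ[K] L, σ • f = f) :
    ∃ a b : MvPolynomial ι K,
      f = φ (map (algebraMap K L) a) / φ (map (algebraMap K L) b) := by
  classical
  have hmap : ∀ σ τ : L ≃ₐ[K] L, map (σ : L →+* L) (map (τ : L →+* L) q) =
      map ((σ * τ : L ≃ₐ[K] L) : L →+* L) q := fun σ τ => by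
    rw [map_map]; rfl
  set N : MvPolynomial ι L := ∏ τ : L ≃ₐ[K] L, map (τ : L →+* L) q with hN
  have hNfix : ∀ σ : L ≃ₐ[K] L, map (σ : L →+* L) N = N := by
    intro σ
    rw [hN, map_prod]
    simp only [hmap]
    exact Fintype.prod_equiv (Equiv.mulLeft σ) _ _ fun _ => rfl
  have hN0 : N ≠ 0 := Finset.prod_ne_zero_iff.2 fun τ _ h =>
    hq (map_injective (τ : L →+* L) τ.injective (by rw [h, map_zero]))
  obtain ⟨r, hr⟩ : q ∣ N := by
    have h1 : map (((1 : L ≃ₐ[K] L)) : L →+* L) q = q := map_id q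
    conv_lhs => rw [← h1]
    exact Finset.dvd_prod_of_mem (fun τ : L ≃ₐ[K] L => map (τ : L →+* L) q) (Finset.mem_univ 1)
  have hφN : φ N ≠ 0 := (map_ne_zero_iff φ hφ).2 hN0
  have hφq : φ q ≠ 0 := (map_ne_zero_iff φ hφ).2 hq
  have hfN : f * φ N = φ (p * r) := by
    rw [hf, hr, map_mul, map_mul]
    field_simp
  have hpfix : ∀ σ : L ≃ₐ[K] L, map (σ : L →+* L) (p * r) = p * r := by
    intro σ
    apply hφ
    rw [← hact, ← hfN, smul_mul', hfix, hact, hNfix]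
  obtain ⟨a, ha⟩ := mem_range_map_of_fixed _ hpfix
  obtain ⟨b, hb⟩ := mem_range_map_of_fixed _ hNfix
  exact ⟨a, b, by rw [ha, hb, eq_div_iff hφN, hfN]⟩

end MvPolynomial

set_option synthInstance.maxHeartbeats 1000000 in
set_option maxHeartbeats 1000000 in
/-- Let `L/K` be a finite Galois extension of fields, `n ≥ 1`, and let
`𝕂_L = L(x₁,…,xₙ)` be the rational function field in `n` variables over `L` (realized as
`FractionRing (MvPolynomial (Fin n) L)`). Let `ρ : Gal(L/K) → GLₙ(K)` be a group
homomorphism, and let `Gal(L/K)` act on `𝕂_L` by field automorphisms via the twisted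
semilinear action in which `σ` acts on coefficients through `σ` and sends the variable
`xⱼ` to `∑ᵢ ρ(σ)ᵢⱼ xᵢ` (the action being packaged as a `MulSemiringAction` satisfying
these two conditions, which determine it uniquely). Then the fixed field of this action
is a purely transcendental extension of `K` of transcendence degree `n`: it is
`K`-isomorphic to the rational function field `K(x₁,…,xₙ)`. -/
theorem statement_8 {K L : Type*} [Field K] [Field L] [Algebra K L]
    [FiniteDimensional K L] [IsGalois K L] (n : ℕ) (hn : 1 ≤ n)
    [MulSemiringAction (L ≃ₐ[K] L) (FractionRing (MvPolynomial (Fin n) L))]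
    (ρ : (L ≃ₐ[K] L) →* GL (Fin n) K)
    (hcoeff : ∀ (σ : L ≃ₐ[K] L) (c : L),
      σ • (algebraMap (MvPolynomial (Fin n) L) (FractionRing (MvPolynomial (Fin n) L))
          (MvPolynomial.C c)) =
        algebraMap (MvPolynomial (Fin n) L) (FractionRing (MvPolynomial (Fin n) L))
          (MvPolynomial.C (σ c)))
    (hvar : ∀ (σ : L ≃ₐ[K] L) (j : Fin n),
      σ • (algebraMap (MvPolynomial (Fin n) L) (FractionRing (MvPolynomial (Fin n) L))
          (MvPolynomial.X j)) =
        ∑ i : Fin n,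
          algebraMap (MvPolynomial (Fin n) L) (FractionRing (MvPolynomial (Fin n) L))
            (MvPolynomial.C (algebraMap K L (((ρ σ) : Matrix (Fin n) (Fin n) K) i j)) *
              MvPolynomial.X i)) :
    ∃ e : FractionRing (MvPolynomial (Fin n) K) ≃+*
        ↥(FixedPoints.subfield (L ≃ₐ[K] L) (FractionRing (MvPolynomial (Fin n) L))),
      ∀ c : K,
        ((e (algebraMap (MvPolynomial (Fin n) K) (FractionRing (MvPolynomial (Fin n) K))
            (MvPolynomial.C c)) : FractionRing (MvPolynomial (Fin n) L))) =
          algebraMap (MvPolynomial (Fin n) L) (FractionRing (MvPolynomial (Fin n) L))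
            (MvPolynomial.C (algebraMap K L c)) := by
  obtain ⟨A, B, hAB, hBA, hA⟩ := exists_matrix_twisted_fixed ρ
  let Φ := MvPolynomial.linearSubstEquiv A B hAB hBA
  have hΦX : ∀ j, Φ (MvPolynomial.X j) = ∑ i, MvPolynomial.C (A i j) * MvPolynomial.X i :=
    MvPolynomial.linearSubst_X A
  have hΦC : ∀ c, Φ (MvPolynomial.C c) = MvPolynomial.C c := MvPolynomial.linearSubst_C A
  let ι := algebraMap (MvPolynomial (Fin n) L) (FractionRing (MvPolynomial (Fin n) L))
  have hι : Function.Injective ι := IsFractionRing.injective _ _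
  let φ : MvPolynomial (Fin n) L →+* FractionRing (MvPolynomial (Fin n) L) :=
    ι.comp (Φ : MvPolynomial (Fin n) L →+* MvPolynomial (Fin n) L)
  have hφ : Function.Injective φ := hι.comp Φ.injective
  have hφX : ∀ j, φ (MvPolynomial.X j) =
      ∑ i, ι (MvPolynomial.C (A i j)) * ι (MvPolynomial.X i) := by
    intro j
    change ι (Φ (MvPolynomial.X j)) = _
    rw [hΦX, map_sum]
    simp only [map_mul]
  have hφC : ∀ c, φ (MvPolynomial.C c) = ι (MvPolynomial.C c) := fun c =>
    congrArg ι (hΦC c)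
  have hcoeff' : ∀ (σ : L ≃ₐ[K] L) (c : L),
      σ • ι (MvPolynomial.C c) = ι (MvPolynomial.C (σ c)) := hcoeff
  have hvar' : ∀ (σ : L ≃ₐ[K] L) (j : Fin n), σ • ι (MvPolynomial.X j) =
      ∑ i, ι (MvPolynomial.C (algebraMap K L (((ρ σ) : Matrix (Fin n) (Fin n) K) i j))) *
        ι (MvPolynomial.X i) := fun σ j => by
    simp only [← map_mul]
    exact hvar σ j
  have hact : ∀ (σ : L ≃ₐ[K] L) p, σ • φ p = φ (MvPolynomial.map (σ : L →+* L) p) := by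
    intro σ p
    refine DFunLike.congr_fun (f := (MulSemiringAction.toRingHom (L ≃ₐ[K] L)
      (FractionRing (MvPolynomial (Fin n) L)) σ).comp φ)
      (g := φ.comp (MvPolynomial.map (σ : L →+* L))) (MvPolynomial.ringHom_ext ?_ ?_) p
    · intro c
      change σ • φ (MvPolynomial.C c) = φ (MvPolynomial.map (σ : L →+* L) (MvPolynomial.C c))
      rw [MvPolynomial.map_C, hφC, hφC, hcoeff']
      rfl
    · intro j
      change σ • φ (MvPolynomial.X j) = φ (MvPolynomial.map (σ : L →+* L) (MvPolynomial.X j))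
      rw [MvPolynomial.map_X, hφX, Finset.smul_sum]
      simp only [smul_mul', hcoeff', hvar', Finset.mul_sum]
      rw [Finset.sum_comm]
      refine Finset.sum_congr rfl fun k _ => ?_
      rw [← hA σ k j]
      simp only [← mul_assoc, ← Finset.sum_mul, map_sum, map_mul]
      congr 1
      exact Finset.sum_congr rfl fun i _ => mul_comm _ _
  have hmapfix : ∀ (σ : L ≃ₐ[K] L) (p : MvPolynomial (Fin n) K),
      MvPolynomial.map (σ : L →+* L) (MvPolynomial.map (algebraMap K L) p) =
        MvPolynomial.map (algebraMap K L) p := by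
    intro σ p
    rw [MvPolynomial.map_map]
    congr 2
    ext c
    simp
  let ψ : MvPolynomial (Fin n) K →+*
      ↥(FixedPoints.subfield (L ≃ₐ[K] L) (FractionRing (MvPolynomial (Fin n) L))) :=
    (φ.comp (MvPolynomial.map (algebraMap K L))).codRestrict _ (by
      intro p σ
      change σ • φ (MvPolynomial.map (algebraMap K L) p) = φ (MvPolynomial.map (algebraMap K L) p)
      rw [hact, hmapfix])
  have hψval : ∀ p, (ψ p : FractionRing (MvPolynomial (Fin n) L)) =
      φ (MvPolynomial.map (algebraMap K L) p) := fun _ => rfl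
  have hψ : Function.Injective ψ := by
    intro p q h
    exact MvPolynomial.map_injective _ (algebraMap K L).injective
      (hφ (congrArg Subtype.val h))
  let e₀ : FractionRing (MvPolynomial (Fin n) K) →+*
      ↥(FixedPoints.subfield (L ≃ₐ[K] L) (FractionRing (MvPolynomial (Fin n) L))) :=
    IsFractionRing.lift hψ
  have he₀ : ∀ p, e₀ (algebraMap _ _ p) = ψ p := fun p => IsFractionRing.lift_algebraMap hψ p
  refine ⟨RingEquiv.ofBijective e₀ ⟨e₀.injective, ?_⟩, ?_⟩
  · rintro ⟨f, hf⟩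
    obtain ⟨p, q, hq, hpq⟩ := IsFractionRing.div_surjective (A := MvPolynomial (Fin n) L) f
    have hq0 : Φ.symm q ≠ 0 := by
      simpa using nonZeroDivisors.ne_zero hq
    obtain ⟨a, b, hab⟩ := MvPolynomial.exists_div_of_fixed φ hφ hact (p := Φ.symm p) hq0
      (by
        change f = ι (Φ (Φ.symm p)) / ι (Φ (Φ.symm q))
        rw [AlgEquiv.apply_symm_apply, AlgEquiv.apply_symm_apply]
        exact hpq.symm) hf
    refine ⟨algebraMap _ _ a / algebraMap _ _ b, Subtype.ext ?_⟩
    rw [map_div₀, he₀, he₀]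
    exact hab.symm
  · intro c
    refine (congrArg Subtype.val (he₀ (MvPolynomial.C c))).trans ?_
    rw [hψval, MvPolynomial.map_C, hφC]
end

section
/- Let K be a field of characteristic different from 2, let d ≥ 1, and set n = 2d+2. Let 𝕂̃ = K(t_1,…,t_n) be the rational function field in n variables over K, let m(x) = ∏_{i=1}^n (x − t_i^2) ∈ 𝕂̃[x], and let h, ℓ ∈ 𝕂̃[x] be the unique pair with h monic of degree d+1, deg ℓ ≤ d, and m(x) = h(x)^2 − ℓ(x). Then ℓ has degree exactly d, ℓ is separable, and the Galois group of ℓ over 𝕂̃ (i.e., the Galois group of a splitting field of ℓ over 𝕂̃) is isomorphic to the symmetric group S_d. -/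
open Polynomial

theorem PowerSeries.exists_eval_eq_zero_of_derivative {F : Type*} [Field F]
    (f : Polynomial (PowerSeries F)) (y₀ : PowerSeries F) (h₀ : PowerSeries.X ∣ f.eval y₀)
    (h₁ : PowerSeries.constantCoeff (f.derivative.eval y₀) ≠ 0) :
    ∃ y, f.eval y = 0 ∧ PowerSeries.X ∣ y - y₀ := by
  let c : ℕ → PowerSeries F := fun n ↦ Nat.recOn n y₀
    fun _ b ↦ b - f.eval b * (f.derivative.eval b)⁻¹
  have hc (n : ℕ) : c (n + 1) = c n - f.eval (c n) * (f.derivative.eval (c n))⁻¹ := rfl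
  have key (n : ℕ) : PowerSeries.X ∣ c n - y₀ ∧ PowerSeries.X ^ (n + 1) ∣ f.eval (c n) := by
    induction n with
    | zero => simpa [c] using h₀
    | succ n ih =>
      obtain ⟨ih₁, ih₂⟩ := ih
      have hX : (PowerSeries.X : PowerSeries F) ∣ f.eval (c n) :=
        (dvd_pow_self _ n.succ_ne_zero).trans ih₂
      have hu : PowerSeries.constantCoeff (f.derivative.eval (c n)) ≠ 0 := by
        have h : PowerSeries.X ∣ f.derivative.eval (c n) - f.derivative.eval y₀ :=
          ih₁.trans (sub_dvd_eval_sub _ _ _)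
        rw [PowerSeries.X_dvd_iff, map_sub, sub_eq_zero] at h
        rwa [h]
      constructor
      · rw [hc, sub_right_comm]
        exact dvd_sub ih₁ (hX.mul_right _)
      · obtain ⟨k, hk⟩ := exists_mul_sq_add_linear_part_eq_eval_add f (c n)
          (-(f.eval (c n) * (f.derivative.eval (c n))⁻¹))
        have hlin : f.derivative.eval (c n) * (f.derivative.eval (c n))⁻¹ = 1 :=
          PowerSeries.mul_inv_cancel _ hu
        have : f.eval (c (n + 1)) =
            k * (f.derivative.eval (c n))⁻¹ ^ 2 * (f.eval (c n)) ^ 2 := by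
          rw [hc, sub_eq_add_neg, ← hk]
          linear_combination - f.eval (c n) * hlin
        rw [this, pow_succ, pow_two (f.eval (c n))]
        exact (mul_dvd_mul ih₂ hX).mul_left _
  have hstep (n k : ℕ) : PowerSeries.X ^ (n + 1) ∣ c (n + k) - c n := by
    induction k with
    | zero => simp
    | succ k ih =>
      rw [← add_assoc, hc, sub_right_comm]
      refine dvd_sub ih (Dvd.dvd.mul_right ?_ _)
      exact (pow_dvd_pow _ (by lia)).trans (key (n + k)).2
  let y : PowerSeries F := PowerSeries.mk fun n ↦ PowerSeries.coeff n (c n)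
  have hy (n : ℕ) : PowerSeries.X ^ (n + 1) ∣ y - c n := by
    rw [PowerSeries.X_pow_dvd_iff]
    intro i hi
    obtain ⟨k, rfl⟩ := Nat.exists_eq_add_of_le (Nat.le_of_lt_succ hi)
    have := PowerSeries.X_pow_dvd_iff.1 (hstep i k) i (by lia)
    rw [map_sub, sub_eq_zero] at this
    simp [y, this]
  refine ⟨y, ?_, by simpa [c] using hy 0⟩
  ext n
  have h : PowerSeries.X ^ (n + 1) ∣ f.eval y := by
    have := dvd_add ((hy n).trans (sub_dvd_eval_sub _ _ f)) (key n).2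
    rwa [sub_add_cancel] at this
  simpa using PowerSeries.X_pow_dvd_iff.1 h n (by lia)

theorem PowerSeries.constantCoeff_eval {F : Type*} [CommRing F] (f : Polynomial (PowerSeries F))
    (y : PowerSeries F) : PowerSeries.constantCoeff (f.eval y) =
      (f.map PowerSeries.constantCoeff).eval (PowerSeries.constantCoeff y) := by
  rw [eval_map, eval, hom_eval₂, RingHom.comp_id]

theorem Polynomial.degree_prod_X_sub_C {R ι : Type*} [CommRing R] [IsDomain R] [Fintype ι]
    (a : ι → R) : (∏ i, (X - C (a i))).degree = (Fintype.card ι : WithBot ℕ) := by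
  simp only [degree_prod, degree_X_sub_C, Finset.sum_const, Finset.card_univ, nsmul_eq_mul, mul_one]

section Roots

variable {F : Type*} [Field F] {d : ℕ}

/-- For `t = a + εy` with `a = α j`, the value of `∏ₖ (x - αₖ²)² - ε² ∏ᵢ (x - εζᵢ)` at `x = t²` is
`ε²` times the value at `y` of this polynomial. -/
noncomputable def perturbedFactor (α : Fin (d + 1) → F) (ζ : Fin d → F) (j : Fin (d + 1)) :
    Polynomial (PowerSeries F) :=
  X ^ 2 * (C (PowerSeries.C (2 * α j)) + C PowerSeries.X * X) ^ 2 *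
    (∏ k ∈ Finset.univ.erase j,
      ((C (PowerSeries.C (α j)) + C PowerSeries.X * X) ^ 2 - C (PowerSeries.C (α k ^ 2)))) ^ 2 -
    ∏ i, ((C (PowerSeries.C (α j)) + C PowerSeries.X * X) ^ 2 -
      C (PowerSeries.X * PowerSeries.C (ζ i)))

theorem eval_perturbed_eq (α : Fin (d + 1) → F) (ζ : Fin d → F) (j : Fin (d + 1))
    (y : PowerSeries F) :
    ((∏ k, (X - C (PowerSeries.C (α k ^ 2)))) ^ 2 - C (PowerSeries.X ^ 2) *
      ∏ i, (X - C (PowerSeries.X * PowerSeries.C (ζ i)))).eval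
        ((PowerSeries.C (α j) + PowerSeries.X * y) ^ 2) =
      PowerSeries.X ^ 2 * (perturbedFactor α ζ j).eval y := by
  rw [perturbedFactor, ← Finset.mul_prod_erase _ _ (Finset.mem_univ j)]
  simp only [eval_sub, eval_mul, eval_pow, eval_prod, eval_X, eval_C, eval_add, map_mul, map_ofNat,
    map_pow, eval_ofNat]
  ring

theorem map_perturbedFactor (α : Fin (d + 1) → F) (ζ : Fin d → F) (j : Fin (d + 1)) :
    (perturbedFactor α ζ j).map PowerSeries.constantCoeff =
      C ((2 * α j * ∏ k ∈ Finset.univ.erase j, (α j ^ 2 - α k ^ 2)) ^ 2) * X ^ 2 -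
        C (α j ^ (2 * d)) := by
  simp only [perturbedFactor, Polynomial.map_sub, Polynomial.map_mul, Polynomial.map_pow,
    Polynomial.map_prod, Polynomial.map_add, Polynomial.map_X, Polynomial.map_C,
    PowerSeries.constantCoeff_C, PowerSeries.constantCoeff_X, map_mul, map_zero, zero_mul,
    add_zero, sub_zero, map_prod, map_pow, map_sub, Finset.prod_const, Finset.card_univ,
    Fintype.card_fin, pow_mul]
  ring

theorem perturbedFactor_map_map (α : Fin (d + 1) → F) (ζ : Fin d → F) (j : Fin (d + 1))
    (σ : F →+* F) (π : Equiv.Perm (Fin d)) (hα : ∀ k, σ (α k) = α k)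
    (hζ : ∀ i, σ (ζ i) = ζ (π i)) :
    (perturbedFactor α ζ j).map (PowerSeries.map σ) = perturbedFactor α ζ j := by
  simp only [perturbedFactor, Polynomial.map_sub, Polynomial.map_mul, Polynomial.map_pow,
    Polynomial.map_prod, Polynomial.map_add, Polynomial.map_X, Polynomial.map_C,
    PowerSeries.map_C, PowerSeries.map_X, map_mul, map_pow, map_ofNat, hα, hζ]
  rw [← Equiv.prod_comp π fun i ↦ (C (PowerSeries.C (α j)) + C PowerSeries.X * X) ^ 2 -
    C PowerSeries.X * C (PowerSeries.C (ζ i)), Polynomial.map_ofNat]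

theorem exists_sqrt_roots_perturbed (h2 : (2 : F) ≠ 0) (hd : 1 ≤ d) (α : Fin (d + 1) → F)
    (ζ : Fin d → F) (hα₀ : ∀ j, α j ≠ 0) (hα : Function.Injective fun j ↦ α j ^ 2) :
    ∃ τ : Fin (d + 1) × ℤˣ → PowerSeries F,
      (∏ k, (X - C (PowerSeries.C (α k ^ 2)))) ^ 2 - C (PowerSeries.X ^ 2) *
        ∏ i, (X - C (PowerSeries.X * PowerSeries.C (ζ i))) = ∏ p, (X - C (τ p ^ 2)) ∧
      ∀ (σ : F →+* F) (π : Equiv.Perm (Fin d)), (∀ k, σ (α k) = α k) →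
        (∀ i, σ (ζ i) = ζ (π i)) → ∀ p, PowerSeries.map σ (τ p) = τ p := by
  set g : Fin (d + 1) → F := fun j ↦ ∏ k ∈ Finset.univ.erase j, (α j ^ 2 - α k ^ 2) with hg
  have hg₀ (j) : g j ≠ 0 := Finset.prod_ne_zero_iff.2 fun k hk ↦
    sub_ne_zero.2 fun h ↦ (Finset.ne_of_mem_erase hk) (hα h).symm
  let y₀ : Fin (d + 1) × ℤˣ → F := fun p ↦ ((p.2 : ℤ) : F) * (α p.1 ^ (d - 1) / (2 * g p.1))
  have hu (s : ℤˣ) : ((s : ℤ) : F) ^ 2 = 1 := by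
    rcases Int.units_eq_one_or s with rfl | rfl <;> simp
  have hu₀ (s : ℤˣ) : ((s : ℤ) : F) ≠ 0 := fun h ↦ by simpa [h] using hu s
  have hy₀ (p) : y₀ p ≠ 0 :=
    mul_ne_zero (hu₀ _) (div_ne_zero (pow_ne_zero _ (hα₀ _)) (mul_ne_zero h2 (hg₀ _)))
  have hmap (j) : (perturbedFactor α ζ j).map PowerSeries.constantCoeff =
      C ((2 * α j * g j) ^ 2) * X ^ 2 - C (α j ^ (2 * d)) := map_perturbedFactor α ζ j
  have hder (p) (y : PowerSeries F) (hy : PowerSeries.constantCoeff y = y₀ p) :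
      PowerSeries.constantCoeff ((perturbedFactor α ζ p.1).derivative.eval y) ≠ 0 := by
    rw [PowerSeries.constantCoeff_eval, hy, ← derivative_map, hmap]
    simp only [derivative_sub, derivative_C, sub_zero, derivative_C_mul, derivative_X_pow,
      eval_mul, eval_C, eval_X, Nat.cast_ofNat, Nat.add_one_sub_one, pow_one]
    exact mul_ne_zero (pow_ne_zero _ (mul_ne_zero (mul_ne_zero h2 (hα₀ _)) (hg₀ _)))
      (mul_ne_zero h2 (hy₀ p))
  have hex (p) : ∃ y : PowerSeries F, (perturbedFactor α ζ p.1).eval y = 0 ∧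
      PowerSeries.constantCoeff y = y₀ p := by
    obtain ⟨y, hy, hy'⟩ := PowerSeries.exists_eval_eq_zero_of_derivative
      (perturbedFactor α ζ p.1) (PowerSeries.C (y₀ p)) (by
        rw [PowerSeries.X_dvd_iff, PowerSeries.constantCoeff_eval, hmap]
        obtain ⟨e, rfl⟩ := Nat.exists_eq_add_of_le' hd
        have := hg₀ p.1
        simp only [y₀, eval_sub, eval_mul, eval_C, eval_pow, eval_X, PowerSeries.constantCoeff_C,
          mul_pow, hu, div_pow, Nat.add_sub_cancel]
        field_simp
        ring) (hder p _ (PowerSeries.constantCoeff_C _))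
    rw [PowerSeries.X_dvd_iff, map_sub, sub_eq_zero, PowerSeries.constantCoeff_C] at hy'
    exact ⟨y, hy, hy'⟩
  choose y hy hyc using hex
  let τ : Fin (d + 1) × ℤˣ → PowerSeries F := fun p ↦
    PowerSeries.C (α p.1) + PowerSeries.X * y p
  refine ⟨τ, ?_, fun σ π hσα hσζ p ↦ ?_⟩
  · have hinj : Function.Injective fun p ↦ τ p ^ 2 := by
      rintro ⟨j, s⟩ ⟨k, s'⟩ h
      obtain rfl : j = k := by
        apply hα
        simpa [τ] using congrArg PowerSeries.constantCoeff h
      have h' : PowerSeries.X * ((y (j, s) - y (j, s')) * (2 * PowerSeries.C (α j) +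
          PowerSeries.X * (y (j, s) + y (j, s')))) = 0 := by
        simp only [τ] at h
        linear_combination h
      have h'' := congrArg PowerSeries.constantCoeff
        ((mul_eq_zero.1 h').resolve_left PowerSeries.X_ne_zero)
      simp only [map_mul, map_sub, map_add, hyc, map_ofNat, PowerSeries.constantCoeff_C,
        PowerSeries.constantCoeff_X, zero_mul, add_zero, map_zero] at h''
      have h₃ := (mul_eq_zero.1 h'').resolve_right (mul_ne_zero h2 (hα₀ j))
      have h₄ : ((s : ℤ) : F) = ((s' : ℤ) : F) :=
        mul_right_cancel₀ (div_ne_zero (pow_ne_zero (d - 1) (hα₀ j)) (mul_ne_zero h2 (hg₀ j)))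
          (sub_eq_zero.1 h₃)
      have h₅ : ¬ (1 : F) = -1 := fun h ↦ h2 (by linear_combination h)
      have h₆ : ¬ (-1 : F) = 1 := fun h ↦ h2 (by linear_combination -h)
      congr 1
      rcases Int.units_eq_one_or s with rfl | rfl <;>
        rcases Int.units_eq_one_or s' with rfl | rfl <;> simp_all
    have hcard : (Finset.univ : Finset (Fin (d + 1) × ℤˣ)).card = 2 * d + 2 := by
      simp [add_mul, mul_comm]
    have hm₁ : ((∏ k, (X - C (PowerSeries.C (α k ^ 2)))) ^ 2).Monic :=
      (monic_prod_of_monic _ _ fun _ _ ↦ monic_X_sub_C _).pow 2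
    have hd₁ : ((∏ k, (X - C (PowerSeries.C (α k ^ 2)))) ^ 2).degree =
        ((2 * d + 2 : ℕ) : WithBot ℕ) := by
      rw [degree_pow, degree_prod_X_sub_C, Fintype.card_fin, nsmul_eq_mul]
      norm_cast
    have hlt : (C (PowerSeries.X ^ 2) *
        ∏ i, (X - C (PowerSeries.X * PowerSeries.C (ζ i)))).degree <
          ((2 * d + 2 : ℕ) : WithBot ℕ) := by
      rw [degree_mul, degree_prod_X_sub_C, degree_C (pow_ne_zero _ PowerSeries.X_ne_zero),
        Fintype.card_fin, zero_add]
      norm_cast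
      lia
    refine eq_of_degree_sub_lt_of_eval_index_eq (v := fun p ↦ τ p ^ 2) Finset.univ hinj.injOn ?_ ?_
    · rw [hcard]
      have hm := hm₁.sub_of_left (hd₁ ▸ hlt)
      have hdeg := (degree_sub_eq_left_of_degree_lt (hd₁ ▸ hlt)).trans hd₁
      rw [← hdeg]
      apply degree_sub_lt_left
      · rw [hdeg, degree_prod_X_sub_C, ← Finset.card_univ, hcard]
      · exact hm.ne_zero
      · rw [hm.leadingCoeff,
          (monic_prod_of_monic _ _ fun _ _ ↦ monic_X_sub_C _).leadingCoeff]
    · intro p _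
      rw [eval_perturbed_eq, hy, mul_zero, eval_prod, Finset.prod_eq_zero (Finset.mem_univ p)]
      simp
  · have hσy : PowerSeries.map σ (y p) = y p := by
      symm
      have hc : PowerSeries.constantCoeff (PowerSeries.map σ (y p)) = y₀ p := by
        rw [← PowerSeries.coeff_zero_eq_constantCoeff_apply, PowerSeries.coeff_map,
          PowerSeries.coeff_zero_eq_constantCoeff_apply, hyc]
        simp [y₀, hg, hσα, map_prod, map_ofNat σ 2]
      refine IsLocalRing.eq_of_eval_eq_zero_of_not_isUnit_sub (f := perturbedFactor α ζ p.1) (hy p)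
        ?_ ?_ ?_
      · rw [← perturbedFactor_map_map α ζ p.1 σ π hσα hσζ, eval_map_apply, hy, map_zero]
      · rw [PowerSeries.isUnit_iff_constantCoeff, map_sub, hc, hyc]
        simp
      · rw [PowerSeries.isUnit_iff_constantCoeff]
        exact (hder p _ (hyc p)).isUnit
    simp [τ, hσα, hσy]

end Roots

theorem Polynomial.Monic.exists_sq_sub_degree_le {F : Type*} [Field F] (h2 : (2 : F) ≠ 0) {d : ℕ}
    {m : F[X]} (hm : m.Monic) (hdeg : m.natDegree = 2 * d + 2) :
    ∃ h l : F[X], h.Monic ∧ h.natDegree = d + 1 ∧ l.degree ≤ d ∧ m = h ^ 2 - l := by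
  suffices ∀ k ≤ d + 1, ∃ h : F[X], h.Monic ∧ h.natDegree = d + 1 ∧
      (h ^ 2 - m).degree ≤ ((2 * d + 1 - k : ℕ) : WithBot ℕ) by
    obtain ⟨h, hh, hhd, hl⟩ := this (d + 1) le_rfl
    refine ⟨h, h ^ 2 - m, hh, hhd, hl.trans ?_, by ring⟩
    exact_mod_cast (by lia)
  intro k hk
  induction k with
  | zero =>
    refine ⟨X ^ (d + 1), monic_X_pow _, natDegree_X_pow _, ?_⟩
    have hlt : ((X ^ (d + 1)) ^ 2 - m).degree < ((2 * d + 2 : ℕ) : WithBot ℕ) := by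
      have hX : ((X ^ (d + 1)) ^ 2 : F[X]).degree = ((2 * d + 2 : ℕ) : WithBot ℕ) := by
        rw [← pow_mul, degree_X_pow]
        congr 1
        ring
      rw [← hX]
      refine degree_sub_lt_left ?_ ((monic_X_pow _).pow _).ne_zero ?_
      · rw [hX, degree_eq_natDegree hm.ne_zero, hdeg]
      · rw [hm.leadingCoeff, ((monic_X_pow _).pow _).leadingCoeff]
    rw [degree_lt_iff_coeff_zero] at hlt
    rw [degree_le_iff_coeff_zero]
    intro i hi
    exact hlt i (by have := (WithBot.coe_lt_coe).1 hi; lia)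
  | succ k ih =>
    obtain ⟨h, hh, hhd, hl⟩ := ih (by lia)
    set c := (h ^ 2 - m).coeff (2 * d + 1 - k) with hc
    have hlow : (C (-c / 2) * X ^ (d - k) : F[X]).degree ≤ ((d - k : ℕ) : WithBot ℕ) :=
      degree_C_mul_X_pow_le _ _
    have hhd' : h.degree = ((d + 1 : ℕ) : WithBot ℕ) := by
      rw [degree_eq_natDegree hh.ne_zero, hhd]
    have hlt : (C (-c / 2) * X ^ (d - k) : F[X]).degree < h.degree := by
      rw [hhd']
      exact hlow.trans_lt (by exact_mod_cast (by lia))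
    refine ⟨h + C (-c / 2) * X ^ (d - k), hh.add_of_left hlt, ?_, ?_⟩
    · exact natDegree_eq_of_degree_eq_some ((degree_add_eq_left_of_degree_lt hlt).trans hhd')
    · have hexp : (h + C (-c / 2) * X ^ (d - k)) ^ 2 - m =
          (h ^ 2 - m) - C c * X ^ (d - k) * h + C (c ^ 2 / 4) * X ^ (2 * (d - k)) := by
        have h4 : (4 : F) ≠ 0 := by
          rw [show (4 : F) = 2 * 2 by norm_num]
          exact mul_ne_zero h2 h2
        have e₁ : (C (-c / 2) * 2 : F[X]) = - C c := by
          rw [← map_ofNat C 2, ← C_mul, ← C_neg]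
          congr 1
          field_simp
        have e₂ : (C (-c / 2) ^ 2 : F[X]) = C (c ^ 2 / 4) := by
          rw [← C_pow]
          congr 1
          field_simp
          norm_num
        rw [pow_mul']
        linear_combination e₁ * X ^ (d - k) * h + e₂ * (X ^ (d - k)) ^ 2
      rw [hexp, degree_le_iff_coeff_zero]
      intro i hi
      have hi : 2 * d + 1 - (k + 1) < i := (WithBot.coe_lt_coe).1 hi
      have h₃ : (C (c ^ 2 / 4) * X ^ (2 * (d - k)) : F[X]).coeff i = 0 := by
        rw [coeff_C_mul_X_pow, if_neg (by lia)]
      rw [coeff_add, h₃, add_zero, coeff_sub, mul_assoc, coeff_C_mul, coeff_X_pow_mul',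
        if_pos (by lia)]
      rcases (show 2 * d + 1 - k ≤ i by lia).eq_or_lt with rfl | hi'
      · have : 2 * d + 1 - k - (d - k) = h.natDegree := by lia
        rw [this, hh.coeff_natDegree, ← hc]
        ring
      · rw [degree_le_iff_coeff_zero] at hl
        rw [hl i (by exact_mod_cast hi'), coeff_eq_zero_of_natDegree_lt (by lia)]
        ring

theorem Polynomial.Monic.eq_of_sq_sub_eq_sq_sub {F : Type*} [Field F] (h2 : (2 : F) ≠ 0) {d : ℕ}
    {h l h' l' : F[X]} (hh : h.Monic) (hd : h.natDegree = d + 1) (hl : l.degree ≤ d)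
    (hh' : h'.Monic) (hd' : h'.natDegree = d + 1) (hl' : l'.degree ≤ d)
    (heq : h ^ 2 - l = h' ^ 2 - l') : h = h' ∧ l = l' := by
  suffices h = h' by
    subst this
    exact ⟨rfl, by linear_combination -heq⟩
  by_contra hne
  have hmul : (h - h') * (h + h') = l - l' := by linear_combination heq
  have hle : (l - l').degree ≤ d := (degree_sub_le _ _).trans (max_le hl hl')
  have hadd : (h + h').coeff (d + 1) = 2 := by
    have e₁ := hh.coeff_natDegree
    have e₂ := hh'.coeff_natDegree
    rw [hd] at e₁
    rw [hd'] at e₂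
    rw [coeff_add, e₁, e₂]
    norm_num
  have hge : ((d + 1 : ℕ) : WithBot ℕ) ≤ (h + h').degree :=
    le_degree_of_ne_zero (hadd ▸ h2)
  have hge' : (0 : WithBot ℕ) ≤ (h - h').degree := zero_le_degree_iff.2 (sub_ne_zero.2 hne)
  rw [← hmul, Polynomial.degree_mul] at hle
  have := (add_le_add hge' hge).trans hle
  rw [zero_add] at this
  exact absurd (Nat.cast_le.1 this) (by lia)

open scoped IntermediateField.algebraAdjoinAdjoin in
theorem AlgebraicIndependent.of_isAlgebraic_adjoin_range {K M ι ι' : Type*} [Field K] [Field M]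
    [Algebra K M] [Finite ι] [Finite ι'] (hcard : Nat.card ι' ≤ Nat.card ι) {x : ι → M}
    (hx : AlgebraicIndependent K x) (τ : ι' → M)
    (halg : ∀ i, IsAlgebraic (IntermediateField.adjoin K (Set.range τ)) (x i)) :
    AlgebraicIndependent K τ := by
  have hle : (Set.range x).encard ≤ (AlgebraicIndependent.matroid K M).eRk (Set.range τ) := by
    rw [← Matroid.eRk_closure_eq]
    refine (AlgebraicIndependent.matroid_indep_iff.2 hx.to_subtype_range).encard_le_eRk_of_subset ?_
    rintro _ ⟨i, rfl⟩
    rw [AlgebraicIndependent.matroid_closure_eq, SetLike.mem_coe, Subalgebra.mem_algebraicClosure]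
    exact (IsFractionRing.isAlgebraic_iff _ (IntermediateField.adjoin K (Set.range τ)) M).2 (halg i)
  have hxc : (Set.range x).encard = Nat.card ι := by
    rw [← Set.image_univ, hx.injective.encard_image, Set.encard_univ, ENat.card_eq_coe_natCard]
  have hcτ : ENat.card ι' ≤ (Set.range τ).encard := by
    rw [ENat.card_eq_coe_natCard]
    exact (Nat.cast_le.2 hcard).trans (hxc ▸ hle.trans (Matroid.eRk_le_encard _ _))
  have hτ : Function.Injective τ := by
    refine Set.injOn_univ.1 (Set.finite_univ.injOn_of_encard_image_eq (le_antisymm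
      (Set.encard_image_le _ _) ?_))
    rwa [Set.image_univ, Set.encard_univ]
  refine .of_subtype_range hτ (AlgebraicIndependent.matroid_indep_iff.1 ?_)
  rw [Matroid.indep_iff_eRk_eq_encard_of_finite (Set.finite_range τ)]
  refine le_antisymm (Matroid.eRk_le_encard _ _) (le_trans ?_ hle)
  rw [hxc, ← Set.image_univ, hτ.encard_image, Set.encard_univ, ENat.card_eq_coe_natCard]
  exact Nat.cast_le.2 hcard

theorem isAlgebraic_of_sq_sub_eq_prod {T M ι κ ν : Type*} [Field T] [Field M] [Algebra T M]
    [Fintype ι] [Fintype κ] [Fintype ν] {d : ℕ} (h2 : (2 : M) ≠ 0) (hι : Fintype.card ι = d + 1)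
    (hκ : Fintype.card κ = d) (hν : Fintype.card ν = 2 * d + 2) {τ : ν → T} {α : ι → M}
    {c : M} (hc : c ≠ 0) {z : κ → M}
    (h : (∏ j, (X - C (α j ^ 2))) ^ 2 - C c * ∏ i, (X - C (z i)) =
      ∏ p, (X - C (algebraMap T M (τ p) ^ 2))) :
    (∀ j, IsAlgebraic T (α j)) ∧ (∀ i, IsAlgebraic T (z i)) ∧ IsAlgebraic T c := by
  have h2' : (2 : T) ≠ 0 := fun h ↦ h2 (by rw [← map_ofNat (algebraMap T M) 2, h, map_zero])
  obtain ⟨H, L, hH, hHd, hL, hHL⟩ := Polynomial.Monic.exists_sq_sub_degree_le h2' (d := d)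
    (m := ∏ p, (X - C (τ p ^ 2))) (monic_prod_of_monic _ _ fun _ _ ↦ monic_X_sub_C _)
    (by rw [natDegree_finsetProd_X_sub_C_eq_card, Finset.card_univ, hν])
  obtain ⟨hα, hz⟩ := Polynomial.Monic.eq_of_sq_sub_eq_sq_sub h2 (d := d)
    (hH.map (algebraMap T M))
    (by rw [natDegree_map_eq_of_injective (algebraMap T M).injective, hHd])
    (l := L.map (algebraMap T M))
    (by rwa [degree_map])
    (monic_prod_of_monic Finset.univ (fun j ↦ X - C (α j ^ 2)) fun _ _ ↦ monic_X_sub_C _)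
    (by rw [natDegree_finsetProd_X_sub_C_eq_card, Finset.card_univ, hι])
    (l' := C c * ∏ i, (X - C (z i)))
    (by rw [Polynomial.degree_mul, degree_C hc, zero_add, degree_prod]; simp [hκ]) (by
      rw [h, ← Polynomial.map_pow, ← Polynomial.map_sub, ← hHL]
      simp [Polynomial.map_prod])
  have hz₀ : L.map (algebraMap T M) ≠ 0 := by
    rw [hz]
    exact mul_ne_zero (C_ne_zero.2 hc) (Finset.prod_ne_zero_iff.2 fun i _ ↦ X_sub_C_ne_zero _)
  refine ⟨fun j ↦ ?_, fun i ↦ ?_, ?_⟩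
  · refine IsAlgebraic.of_pow two_pos ⟨H, hH.ne_zero, ?_⟩
    rw [aeval_def, eval₂_eq_eval_map, hα, eval_prod, Finset.prod_eq_zero (Finset.mem_univ j)]
    simp
  · refine ⟨L, fun h ↦ hz₀ (by simp [h]), ?_⟩
    rw [aeval_def, eval₂_eq_eval_map, hz, eval_mul, eval_prod,
      Finset.prod_eq_zero (Finset.mem_univ i), mul_zero]
    simp
  · have := congrArg leadingCoeff hz
    rw [leadingCoeff_map, leadingCoeff_mul, leadingCoeff_C,
      (monic_prod_of_monic _ _ fun _ _ ↦ monic_X_sub_C _).leadingCoeff, mul_one] at this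
    exact this ▸ isAlgebraic_algebraMap _

theorem Polynomial.gal_mulEquiv_perm_of_map_eq {k M ι : Type*} [Field k] [Field M] [Algebra k M]
    [Fintype ι] {l : k[X]} {c : M} (hc : c ≠ 0) {z : ι → M} (hz : Function.Injective z)
    (hl : l.map (algebraMap k M) = C c * ∏ i, (X - C (z i)))
    (hφ : ∀ π : Equiv.Perm ι, ∃ φ : M ≃ₐ[k] M, ∀ i, φ (z i) = z (π i)) :
    l.degree = (Fintype.card ι : WithBot ℕ) ∧ l.Separable ∧
      Nonempty (l.Gal ≃* Equiv.Perm ι) := by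
  classical
  refine ⟨?_, ?_, ?_⟩
  · rw [← degree_map l (algebraMap k M), hl, degree_mul, degree_C hc, zero_add, degree_prod]
    simp
  · rw [← separable_map (algebraMap k M), hl]
    refine Separable.unit_mul (hc.isUnit.map C) ?_
    exact separable_prod_X_sub_C_iff.2 hz
  · have hl₀ : l.map (algebraMap k M) ≠ 0 := by
      rw [hl]
      exact mul_ne_zero (C_ne_zero.2 hc) (Finset.prod_ne_zero_iff.2 fun i _ ↦ X_sub_C_ne_zero _)
    have : Fact ((l.map (algebraMap k M)).Splits) := ⟨by
      rw [hl]
      exact (Splits.C c).mul (Splits.prod fun i _ ↦ Splits.X_sub_C _)⟩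
    have hmem (x : M) : x ∈ l.rootSet M ↔ ∃ i, z i = x := by
      rw [mem_rootSet', and_iff_right hl₀, aeval_def, eval₂_eq_eval_map, hl, eval_mul, eval_C,
        mul_eq_zero, or_iff_right hc, eval_prod, Finset.prod_eq_zero_iff]
      simp [sub_eq_zero, eq_comm]
    let e : ι ≃ l.rootSet M := Equiv.ofBijective (fun i ↦ ⟨z i, (hmem _).2 ⟨i, rfl⟩⟩)
      ⟨fun i j h ↦ hz (congrArg Subtype.val h), fun x ↦ by
        obtain ⟨i, hi⟩ := (hmem x).1 x.2
        exact ⟨i, Subtype.ext hi⟩⟩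
    refine ⟨(MulEquiv.ofBijective (Gal.galActionHom l M)
      ⟨Gal.galActionHom_injective l M, fun ρ ↦ ?_⟩).trans e.permCongrHom.symm⟩
    obtain ⟨φ, hφ⟩ := hφ (e.permCongrHom.symm ρ)
    refine ⟨Gal.restrict l M φ, Equiv.ext fun x ↦ Subtype.ext ?_⟩
    obtain ⟨i, rfl⟩ := e.surjective x
    rw [Gal.galActionHom_restrict]
    refine (hφ i).trans ?_
    have : ρ (e i) = e (e.permCongrHom.symm ρ i) := by simp [Equiv.permCongrHom]
    rw [this]
    rfl

theorem PowerSeries.transcendental_X {F : Type*} [CommRing F] :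
    Transcendental F (PowerSeries.X : PowerSeries F) := by
  rw [transcendental_iff_injective]
  have : Polynomial.aeval (PowerSeries.X : PowerSeries F) =
      Polynomial.coeToPowerSeries.algHom (R := F) F :=
    Polynomial.algHom_ext (by simp [Polynomial.coeToPowerSeries.algHom_apply])
  rw [this]
  intro p q h
  simpa [Polynomial.coeToPowerSeries.algHom_apply] using h

theorem AlgebraicIndependent.sumElim_powerSeries_X {K F M ι : Type*} [Field K] [Field F] [Field M]
    [Algebra K F] [Algebra (PowerSeries F) M] [FaithfulSMul (PowerSeries F) M] [Algebra K M]
    [IsScalarTower K (PowerSeries F) M] {w : ι → F} (hw : AlgebraicIndependent K w) :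
    AlgebraicIndependent K (algebraMap (PowerSeries F) M ∘
      Sum.elim (fun _ : Unit ↦ PowerSeries.X) (PowerSeries.C ∘ w)) := by
  have hX : AlgebraicIndependent F fun _ : Unit ↦ (PowerSeries.X : PowerSeries F) :=
    algebraicIndependent_unique_type_iff.2 PowerSeries.transcendental_X
  exact (hw.sumElim_comp hX).map' (f := IsScalarTower.toAlgHom K (PowerSeries F) M)
    (FaithfulSMul.algebraMap_injective _ _)

theorem PowerSeries.exists_ringEquiv_fractionRing {F M : Type*} [Field F] [Field M]
    [Algebra (PowerSeries F) M] [IsFractionRing (PowerSeries F) M] (σ : F ≃+* F) :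
    ∃ φ : M ≃+* M, ∀ r : PowerSeries F,
      φ (algebraMap _ M r) = algebraMap _ M (PowerSeries.map (σ : F →+* F) r) := by
  let e : PowerSeries F ≃+* PowerSeries F := RingEquiv.ofRingHom
    (PowerSeries.map (σ : F →+* F)) (PowerSeries.map (σ.symm : F →+* F))
    (by ext; simp) (by ext; simp)
  exact ⟨IsFractionRing.ringEquivOfRingEquiv e, fun r ↦
    IsFractionRing.ringEquivOfRingEquiv_algebraMap e r⟩

theorem MvPolynomial.X_sq_injective {K ι : Type*} [Field K] :
    Function.Injective fun i : ι ↦ (MvPolynomial.X i : MvPolynomial ι K) ^ 2 := by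
  classical
  intro i j h
  by_contra hij
  have := congrArg (MvPolynomial.eval (Pi.single i 1)) h
  simp [Ne.symm hij] at this

/-- Let `K` be a field of characteristic different from `2`, `d ≥ 1`,
`n = 2d + 2`, and let `𝕂̃ = K(t₁,…,tₙ)` be the rational function field in `n` variables
over `K` (realized as a fraction field of `MvPolynomial (Fin n) K`). Let
`m(x) = ∏ᵢ (x - tᵢ²)` and let `(h, ℓ)` be the unique pair with `h` monic of degree
`d + 1`, `deg ℓ ≤ d` and `m = h² - ℓ`. Then `ℓ` has degree exactly `d`, `ℓ` is
separable, and the Galois group of `ℓ` over `𝕂̃` is isomorphic to `S_d`. -/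
theorem statement_10 {K : Type*} [Field K] (h2 : (2 : K) ≠ 0) (d : ℕ) (hd : 1 ≤ d)
    (n : ℕ) (hn : n = 2 * d + 2)
    (Kt : Type*) [Field Kt] [Algebra (MvPolynomial (Fin n) K) Kt]
    [IsFractionRing (MvPolynomial (Fin n) K) Kt]
    (t : Fin n → Kt) (ht : ∀ i, t i = algebraMap (MvPolynomial (Fin n) K) Kt (MvPolynomial.X i))
    (m : Polynomial Kt) (hm : m = ∏ i, (X - C (t i ^ 2)))
    (h l : Polynomial Kt) (hmon : h.Monic) (hhdeg : h.natDegree = d + 1)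
    (hldeg : l.degree ≤ (d : WithBot ℕ)) (hhl : m = h ^ 2 - l) :
    l.degree = (d : WithBot ℕ) ∧ l.Separable ∧
      Nonempty (l.Gal ≃* Equiv.Perm (Fin d)) := by
  let S := Fin (d + 1) ⊕ Fin d
  let F := FractionRing (MvPolynomial S K)
  let M := FractionRing (PowerSeries F)
  let w : S → F := fun s ↦ algebraMap (MvPolynomial S K) F (MvPolynomial.X s)
  have hw : AlgebraicIndependent K w :=
    (MvPolynomial.algebraicIndependent_X S K).map' (f := IsScalarTower.toAlgHom K _ F)
      (IsFractionRing.injective _ F)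
  obtain ⟨τ, hτ, hfix⟩ := exists_sqrt_roots_perturbed
    (fun h ↦ h2 ((algebraMap K F).injective (by rw [map_ofNat, h, map_zero]))) hd
    (w ∘ Sum.inl) (w ∘ Sum.inr) (fun j ↦ hw.ne_zero _) (fun i j hij ↦ by
      apply Sum.inl_injective
      apply MvPolynomial.X_sq_injective (K := K)
      apply IsFractionRing.injective (MvPolynomial S K) F
      simpa [w] using hij)
  let f : PowerSeries F →+* M := algebraMap (PowerSeries F) M
  have hf : Function.Injective f := IsFractionRing.injective _ M
  have hfX : f PowerSeries.X ^ 2 ≠ 0 :=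
    pow_ne_zero 2 fun h ↦ PowerSeries.X_ne_zero (hf (h.trans (map_zero f).symm))
  have h2M : (2 : M) ≠ 0 := fun h ↦
    h2 ((algebraMap K M).injective (by rw [map_ofNat, h, map_zero]))
  have hM : (∏ k, (X - C (f (PowerSeries.C (w (.inl k))) ^ 2))) ^ 2 - C (f PowerSeries.X ^ 2) *
      ∏ i, (X - C (f (PowerSeries.X * PowerSeries.C (w (.inr i))))) =
        ∏ p, (X - C (f (τ p) ^ 2)) := by
    have := congrArg (Polynomial.map f) hτ
    simpa only [Polynomial.map_sub, Polynomial.map_mul, Polynomial.map_pow, Polynomial.map_prod,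
      Polynomial.map_X, Polynomial.map_C, map_pow, Function.comp_apply] using this
  have hρ : AlgebraicIndependent K (f ∘ τ) := by
    have hx := AlgebraicIndependent.sumElim_powerSeries_X (M := M) hw
    refine AlgebraicIndependent.of_isAlgebraic_adjoin_range ?_ hx _ ?_
    · simp [S]
      lia
    · obtain ⟨hα, hz, hc⟩ := isAlgebraic_of_sq_sub_eq_prod (d := d)
        (T := IntermediateField.adjoin K (Set.range (f ∘ τ))) (M := M)
        (τ := fun p ↦ ⟨f (τ p), IntermediateField.subset_adjoin _ _ ⟨p, rfl⟩⟩) h2M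
        (by simp) (by simp) (by simp [add_mul, mul_comm]) hfX hM
      have hX := hc.of_pow two_pos
      rintro (_ | j | i)
      · exact hX
      · exact hα j
      · have := (hX.inv).mul (hz i)
        rwa [map_mul, inv_mul_cancel_left₀ (ne_zero_pow two_ne_zero hfX)] at this
  let e : Fin n ≃ Fin (d + 1) × ℤˣ := Fintype.equivOfCardEq (by simp [hn, add_mul, mul_comm])
  let g : MvPolynomial (Fin n) K →+* M :=
    (MvPolynomial.aeval (f ∘ τ ∘ e) : MvPolynomial (Fin n) K →ₐ[K] M)
  have hg : Function.Injective g := hρ.comp e e.injective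
  algebraize [(IsFractionRing.lift hg : Kt →+* M)]
  have hgt (i) : algebraMap Kt M (t i) = f (τ (e i)) := by
    rw [ht]
    refine (IsFractionRing.lift_algebraMap hg _).trans ?_
    exact MvPolynomial.aeval_X _ _
  have hl : l.map (algebraMap Kt M) = C (f PowerSeries.X ^ 2) *
      ∏ i, (X - C (f (PowerSeries.X * PowerSeries.C (w (.inr i))))) := by
    refine (Polynomial.Monic.eq_of_sq_sub_eq_sq_sub h2M (d := d) (hmon.map (algebraMap Kt M))
      (by rw [natDegree_map_eq_of_injective (algebraMap Kt M).injective, hhdeg])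
      (by rwa [degree_map]) (monic_prod_of_monic Finset.univ
        (fun k ↦ X - C (f (PowerSeries.C (w (.inl k))) ^ 2)) fun _ _ ↦ monic_X_sub_C _)
      (by rw [natDegree_finsetProd_X_sub_C_eq_card, Finset.card_univ, Fintype.card_fin]) ?_ ?_).2
    · rw [Polynomial.degree_mul, degree_C hfX, zero_add, degree_prod_X_sub_C, Fintype.card_fin]
    · rw [hM, ← Polynomial.map_pow, ← Polynomial.map_sub, ← hhl, hm, Polynomial.map_prod,
        ← e.prod_comp]
      simp [hgt]
  simpa using gal_mulEquiv_perm_of_map_eq hfX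
    (z := fun i ↦ f (PowerSeries.X * PowerSeries.C (w (.inr i))))
    (fun i j hij ↦ Sum.inr_injective <| hw.injective <| PowerSeries.C_injective <|
      mul_left_cancel₀ PowerSeries.X_ne_zero (hf hij)) hl fun π ↦ by
    let σ : F ≃+* F := IsFractionRing.ringEquivOfRingEquiv
      (MvPolynomial.renameEquiv K (Equiv.sumCongr (Equiv.refl (Fin (d + 1))) π)).toRingEquiv
    have hσ (s) : σ (w s) = w (Equiv.sumCongr (Equiv.refl _) π s) :=
      (IsFractionRing.ringEquivOfRingEquiv_algebraMap _ _).trans (by simp [w, S])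
    have hσK (k) : σ (algebraMap K F k) = algebraMap K F k := by
      rw [IsScalarTower.algebraMap_apply K (MvPolynomial S K) F]
      exact (IsFractionRing.ringEquivOfRingEquiv_algebraMap _ _).trans
        (congrArg _ (AlgEquiv.commutes _ k))
    obtain ⟨φ, hφ⟩ := PowerSeries.exists_ringEquiv_fractionRing (M := M) σ
    have hφt : (φ : M →+* M).comp (algebraMap Kt M) = algebraMap Kt M := by
      apply IsLocalization.ringHom_ext (nonZeroDivisors (MvPolynomial (Fin n) K))
      refine MvPolynomial.ringHom_ext (fun k ↦ ?_) fun i ↦ ?_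
      · have hC : algebraMap Kt M (algebraMap _ Kt (MvPolynomial.C k)) =
            f (PowerSeries.C (algebraMap K F k)) :=
          (IsFractionRing.lift_algebraMap hg _).trans ((MvPolynomial.aeval_C (f ∘ τ ∘ e) k).trans
            ((IsScalarTower.algebraMap_apply K (PowerSeries F) M k).trans
              (congrArg f PowerSeries.algebraMap_apply)))
        simp only [RingHom.comp_apply, hC]
        refine (hφ _).trans ?_
        rw [PowerSeries.map_C]
        exact congrArg (fun a ↦ f (PowerSeries.C a)) (hσK k)
      · simp only [RingHom.comp_apply, ← ht, hgt]
        refine (hφ _).trans ?_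
        rw [hfix (σ : F →+* F) π (fun k ↦ hσ _) fun i ↦ hσ _]
    refine ⟨AlgEquiv.ofRingEquiv (f := φ) fun x ↦ RingHom.congr_fun hφt x, fun i ↦ ?_⟩
    refine (hφ _).trans ?_
    simp [hσ, f]
end

section
/- Let K be a field of characteristic different from 2, let d ≥ 1, and set n = 2d+2. Let 𝕂̃ = K(t_1,…,t_n) be the rational function field in n variables over K, let m(x) = ∏_{i=1}^n (x − t_i^2) ∈ 𝕂̃[x], and let h, ℓ ∈ 𝕂̃[x] be the unique pair with h monic of degree d+1, deg ℓ ≤ d, and m(x) = h(x)^2 − ℓ(x). Write ℓ(x) = ℓ_d x^d + ⋯ + ℓ_0 with ℓ_i ∈ 𝕂̃. Then the subfield K(ℓ_0,…,ℓ_d) of 𝕂̃ is algebraically closed in 𝕂̃; that is, every element of 𝕂̃ that is algebraic over K(ℓ_0,…,ℓ_d) already lies in K(ℓ_0,…,ℓ_d). -/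
open Polynomial

/-- `h` is the polynomial part of the square root of `m` (of degree `d + 1`), and `l` is the
remainder: `m = h ^ 2 - l`. -/
structure IsSqrtPair {R : Type*} [CommRing R] (d : ℕ) (m h l : R[X]) : Prop where
  monic : h.Monic
  natDegree_eq : h.natDegree = d + 1
  degree_le : l.degree ≤ (d : WithBot ℕ)
  eq : m = h ^ 2 - l

namespace IsSqrtPair

theorem exists_of_monic {R : Type*} [CommRing R] [Nontrivial R] (h2 : IsUnit (2 : R)) (d : ℕ)
    {m : R[X]} (hm : m.Monic) (hdeg : m.natDegree = 2 * d + 2) :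
    ∃ h l, IsSqrtPair d m h l := by
  obtain ⟨c2, hc2⟩ := h2.exists_right_inv
  have key : ∀ k ≤ d + 1, ∃ h : R[X], h.Monic ∧ h.natDegree = d + 1 ∧
      (h ^ 2 - m).degree < ((2 * d + 2 - k : ℕ) : WithBot ℕ) := by
    intro k
    induction k with
    | zero =>
      intro _
      refine ⟨X ^ (d + 1), monic_X_pow _, natDegree_X_pow _, ?_⟩
      have e : ((X : R[X]) ^ (d + 1)) ^ 2 = X ^ (2 * d + 2) := by ring
      rw [e]
      have hd1 : (X ^ (2 * d + 2) : R[X]).degree = ((2 * d + 2 : ℕ) : WithBot ℕ) := degree_X_pow _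
      have hm1 : m.degree = ((2 * d + 2 : ℕ) : WithBot ℕ) := by
        rw [degree_eq_natDegree hm.ne_zero, hdeg]
      rw [Nat.sub_zero, ← hd1]
      exact degree_sub_lt_left (hd1.trans hm1.symm) (monic_X_pow _).ne_zero
        (by rw [(monic_X_pow _).leadingCoeff, hm.leadingCoeff])
    | succ k ih =>
      intro hk
      obtain ⟨h, hmon, hnat, hlt⟩ := ih (by omega)
      set c := (h ^ 2 - m).coeff (2 * d + 1 - k) with hc
      have hpd : (C (-(c2 * c)) * X ^ (d - k) : R[X]).degree < h.degree := by
        refine (degree_C_mul_X_pow_le _ _).trans_lt ?_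
        rw [degree_eq_natDegree hmon.ne_zero, hnat]
        exact_mod_cast (by omega : d - k < d + 1)
      refine ⟨h + C (-(c2 * c)) * X ^ (d - k), hmon.add_of_left hpd,
        by rw [natDegree_add_eq_left_of_degree_lt hpd, hnat], ?_⟩
      have e : (h + C (-(c2 * c)) * X ^ (d - k)) ^ 2 - m
          = (h ^ 2 - m) - C c * (h * X ^ (d - k)) + C ((c2 * c) ^ 2) * X ^ (2 * (d - k)) := by
        have : (C c : R[X]) = C 2 * C c2 * C c := by rw [← C_mul, hc2, C_1, one_mul]
        rw [this]
        simp only [C_neg, C_mul, C_pow, map_ofNat]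
        ring
      rw [e, degree_lt_iff_coeff_zero]
      rw [degree_lt_iff_coeff_zero] at hlt
      intro j hj
      have h3 : (C ((c2 * c) ^ 2) * X ^ (2 * (d - k)) : R[X]).coeff j = 0 := by
        rw [coeff_C_mul_X_pow, if_neg (by omega)]
      rw [coeff_add, h3, add_zero, coeff_sub, coeff_C_mul]
      rcases eq_or_lt_of_le hj with hj' | hj'
      · have : j = (d + 1) + (d - k) := by omega
        have h4 : h.coeff (d + 1) = 1 := by rw [← hnat]; exact hmon
        rw [this, coeff_mul_X_pow, h4, mul_one, hc]
        rw [show 2 * d + 1 - k = d + 1 + (d - k) by omega, sub_self]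
      · rw [hlt j (by omega), show j = (j - (d - k)) + (d - k) by omega, coeff_mul_X_pow,
          coeff_eq_zero_of_natDegree_lt (by omega), mul_zero, sub_zero]
  obtain ⟨h, hmon, hnat, hlt⟩ := key (d + 1) le_rfl
  refine ⟨h, h ^ 2 - m, hmon, hnat, ?_, by ring⟩
  rw [show 2 * d + 2 - (d + 1) = d + 1 by omega] at hlt
  exact Order.le_of_lt_succ (by exact_mod_cast hlt)

theorem unique {R : Type*} [CommRing R] [IsDomain R] (h2 : (2 : R) ≠ 0) {d : ℕ}
    {m h l h' l' : R[X]} (H : IsSqrtPair d m h l) (H' : IsSqrtPair d m h' l') :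
    h = h' ∧ l = l' := by
  have hsum : (h + h').coeff (d + 1) = 2 := by
    have h3 : h.coeff (d + 1) = 1 := by rw [← H.natDegree_eq]; exact H.monic
    have h4 : h'.coeff (d + 1) = 1 := by rw [← H'.natDegree_eq]; exact H'.monic
    rw [coeff_add, h3, h4]; norm_num
  have e : (h + h') * (h - h') = l - l' := by
    linear_combination H'.eq - H.eq
  have hh : h = h' := by
    by_contra hne
    have hs : ((d + 1 : ℕ) : WithBot ℕ) ≤ (h + h').degree :=
      le_degree_of_ne_zero (by rw [hsum]; exact h2)
    have hle : (l - l').degree ≤ (d : WithBot ℕ) :=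
      (degree_sub_le _ _).trans (max_le H.degree_le H'.degree_le)
    rw [← e, degree_mul] at hle
    have h0 : 0 ≤ (h - h').degree := zero_le_degree_iff.mpr (sub_ne_zero.mpr hne)
    have : ((d + 1 : ℕ) : WithBot ℕ) ≤ d := by
      calc ((d + 1 : ℕ) : WithBot ℕ) = (d + 1 : ℕ) + 0 := by simp
        _ ≤ _ := add_le_add hs h0
        _ ≤ _ := hle
    have := WithBot.coe_le_coe.mp this
    simp at this
  refine ⟨hh, ?_⟩
  subst hh
  linear_combination H.eq - H'.eq

theorem map {R S : Type*} [CommRing R] [CommRing S] [Nontrivial S] {d : ℕ} {m h l : R[X]}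
    (H : IsSqrtPair d m h l) (f : R →+* S) : IsSqrtPair d (m.map f) (h.map f) (l.map f) where
  monic := H.monic.map f
  natDegree_eq := by rw [H.monic.natDegree_map, H.natDegree_eq]
  degree_le := degree_map_le.trans H.degree_le
  eq := by rw [H.eq]; simp

theorem monic_left {R : Type*} [CommRing R] [Nontrivial R] {d : ℕ} {m h l : R[X]}
    (H : IsSqrtPair d m h l) : m.Monic ∧ m.natDegree = 2 * d + 2 := by
  have hm : (h ^ 2).Monic := H.monic.pow 2
  have hn : (h ^ 2).natDegree = 2 * d + 2 := by rw [H.monic.natDegree_pow, H.natDegree_eq]; ring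
  have hlt : l.degree < (h ^ 2).degree := by
    rw [degree_eq_natDegree hm.ne_zero, hn]
    exact H.degree_le.trans_lt (by exact_mod_cast (by omega : d < 2 * d + 2))
  rw [H.eq]
  exact ⟨hm.sub_of_left hlt, by
    rw [sub_eq_add_neg, natDegree_add_eq_left_of_degree_lt (by rwa [degree_neg]), hn]⟩

end IsSqrtPair

/-- Over an algebraically closed field a monic polynomial is a product of linear factors indexed by
any finite set of the right size. -/
theorem exists_prod_X_sub_C_eq {E ι : Type*} [Field E] [IsAlgClosed E] [DecidableEq ι]
    (s : Finset ι) (q : E[X]) (hq : q.Monic) (hdeg : q.natDegree = s.card) :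
    ∃ r : ι → E, ∏ k ∈ s, (X - C (r k)) = q := by
  induction s using Finset.induction_on generalizing q with
  | empty =>
    exact ⟨0, by simpa using (eq_one_of_monic_natDegree_zero hq (by simpa using hdeg)).symm⟩
  | insert a s ha ih =>
    rw [Finset.card_insert_of_notMem ha] at hdeg
    obtain ⟨z, hz⟩ := IsAlgClosed.exists_root q (fun h0 => by
      have := natDegree_eq_zero_iff_degree_le_zero.mpr h0.le
      omega)
    obtain ⟨p, rfl⟩ := dvd_iff_isRoot.mpr hz
    have hp : p.Monic := (monic_X_sub_C z).of_mul_monic_left hq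
    rw [(monic_X_sub_C z).natDegree_mul hp, natDegree_X_sub_C] at hdeg
    obtain ⟨r, hr⟩ := ih p hp (by omega)
    refine ⟨Function.update r a z, ?_⟩
    rw [Finset.prod_insert ha, Function.update_self, ← hr]
    congr 1
    refine Finset.prod_congr rfl fun k hk => ?_
    rw [Function.update_of_ne (by rintro rfl; exact ha hk)]

section Specialization

variable {K ι : Type*} [Field K] [Fintype ι] {d : ℕ} {h l : (MvPolynomial ι K)[X]}

/-- Every pair `(h', l')` over an algebraically closed field for which `h' ^ 2 - l'` has roots
`r i` is a specialization of the pair attached to the generic polynomial `∏ i, (X - X i ^ 2)`. -/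
theorem IsSqrtPair.exists_specialization {E : Type*} [Field E] [IsAlgClosed E] [Algebra K E]
    (h2 : (2 : E) ≠ 0) (H : IsSqrtPair d (∏ i : ι, (X - C (MvPolynomial.X i ^ 2))) h l)
    {h' l' : E[X]} (r : ι → E) (H' : IsSqrtPair d (∏ i, (X - C (r i))) h' l') :
    ∃ φ : MvPolynomial ι K →ₐ[K] E, h.map (φ : MvPolynomial ι K →+* E) = h' ∧
      l.map (φ : MvPolynomial ι K →+* E) = l' ∧ ∀ i, φ (MvPolynomial.X i) ^ 2 = r i := by
  choose s hs using fun i => IsAlgClosed.exists_pow_nat_eq (r i) (n := 2) (by norm_num)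
  let φ : MvPolynomial ι K →ₐ[K] E := MvPolynomial.aeval s
  have hφ : ∀ i, φ (MvPolynomial.X i) ^ 2 = r i := fun i => by simp [φ, hs]
  have H'' := H.map (φ : MvPolynomial ι K →+* E)
  have e : (∏ i : ι, (X - C (MvPolynomial.X i ^ 2 : MvPolynomial ι K))).map
      (φ : MvPolynomial ι K →+* E) = ∏ i, (X - C (r i)) := by
    simp [Polynomial.map_prod, ← hφ]
  rw [e] at H''
  exact ⟨φ, (H''.unique h2 H').1, (H''.unique h2 H').2, hφ⟩

theorem isSqrtPair_of_degree_lt {R : Type*} [CommRing R] [Nontrivial R] {p l : R[X]}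
    (hp : p.degree < ((d + 1 : ℕ) : WithBot ℕ)) (hl : l.degree < ((d + 1 : ℕ) : WithBot ℕ)) :
    IsSqrtPair d ((X ^ (d + 1) + p) ^ 2 - l) (X ^ (d + 1) + p) l where
  monic := monic_X_pow_add hp
  natDegree_eq := by
    rw [natDegree_add_eq_left_of_degree_lt (by rwa [degree_X_pow]), natDegree_X_pow]
  degree_le := Order.le_of_lt_succ (by exact_mod_cast hl)
  eq := rfl

/-- The coefficients of the generic square root pair are algebraically independent. -/
theorem IsSqrtPair.algebraicIndependent_coeff (h2 : (2 : K) ≠ 0) (hι : Fintype.card ι = 2 * d + 2)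
    (H : IsSqrtPair d (∏ i : ι, (X - C (MvPolynomial.X i ^ 2))) h l) :
    AlgebraicIndependent K (Sum.elim (fun i : Fin (d + 1) => h.coeff (i : ℕ))
      (fun i : Fin (d + 1) => l.coeff (i : ℕ))) := by
  classical
  let B := MvPolynomial (Fin (d + 1) ⊕ Fin (d + 1)) K
  let E := AlgebraicClosure (FractionRing B)
  have hinj : Function.Injective (IsScalarTower.toAlgHom K B E) :=
    (algebraMap (FractionRing B) E).injective.comp (IsFractionRing.injective B (FractionRing B))
  have hv := (MvPolynomial.algebraicIndependent_X (Fin (d + 1) ⊕ Fin (d + 1)) K).map' hinj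
  set v := IsScalarTower.toAlgHom K B E ∘ MvPolynomial.X
  have h2E : (2 : E) ≠ 0 := by
    rw [← map_ofNat (algebraMap K E) 2]
    exact (map_ne_zero (algebraMap K E)).mpr h2
  have H' := isSqrtPair_of_degree_lt (d := d) (ofFn_degree_lt (v ∘ Sum.inl))
    (ofFn_degree_lt (v ∘ Sum.inr))
  obtain ⟨r, hr⟩ := exists_prod_X_sub_C_eq (Finset.univ : Finset ι) _ H'.monic_left.1
    (H'.monic_left.2.trans (by simp [hι]))
  rw [← hr] at H'
  obtain ⟨φ, hφh, hφl, -⟩ := H.exists_specialization h2E r H'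
  refine AlgebraicIndependent.of_comp φ ?_
  convert! hv using 1
  ext (i | i)
  · have := congr_arg (coeff · (i : ℕ)) hφh
    simpa [coeff_X_pow, i.2.ne, ofFn_coeff_eq_val_of_lt _ i.2] using this
  · have := congr_arg (coeff · (i : ℕ)) hφl
    simpa [ofFn_coeff_eq_val_of_lt _ i.2] using this

end Specialization

/-- The coefficients of the remainder `l` stay algebraically independent on some locus where two
given variables vanish. -/
theorem IsSqrtPair.exists_specialization_eq_zero.{u, v} {K : Type u} {ι : Type v} [Field K]
    [Fintype ι] {d : ℕ} {h l : (MvPolynomial ι K)[X]} (h2 : (2 : K) ≠ 0) (hd : 1 ≤ d)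
    (hι : Fintype.card ι = 2 * d + 2)
    (H : IsSqrtPair d (∏ i : ι, (X - C (MvPolynomial.X i ^ 2))) h l) (a b : ι) (hab : a ≠ b) :
    ∃ (E : Type u) (_ : Field E) (_ : Algebra K E) (φ : MvPolynomial ι K →ₐ[K] E),
      φ (MvPolynomial.X a) = 0 ∧ φ (MvPolynomial.X b) = 0 ∧
      AlgebraicIndependent K (fun i : Fin (d + 1) => φ (l.coeff (i : ℕ))) := by
  classical
  let B := MvPolynomial (Fin (d + 1)) K
  let E := AlgebraicClosure (FractionRing B)
  have hinj : Function.Injective (IsScalarTower.toAlgHom K B E) :=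
    (algebraMap (FractionRing B) E).injective.comp (IsFractionRing.injective B (FractionRing B))
  have hv := (MvPolynomial.algebraicIndependent_X (Fin (d + 1)) K).map' hinj
  set v := IsScalarTower.toAlgHom K B E ∘ MvPolynomial.X
  have h2E : (2 : E) ≠ 0 := by
    rw [← map_ofNat (algebraMap K E) 2]
    exact (map_ne_zero (algebraMap K E)).mpr h2
  let y0 := v ⟨0, by omega⟩
  let y1 := v ⟨1, by omega⟩
  obtain ⟨s, hs⟩ := IsAlgClosed.exists_pow_nat_eq y0 (n := 2) (by norm_num)
  have hs0 : s ≠ 0 := by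
    rintro rfl
    exact hv.ne_zero ⟨0, by omega⟩ (by simpa [y0] using hs.symm)
  have hpdeg : (C (y1 / (2 * s)) * X + C s).degree < ((d + 1 : ℕ) : WithBot ℕ) :=
    degree_linear_le.trans_lt (by exact_mod_cast (by omega : 1 < d + 1))
  have H' := isSqrtPair_of_degree_lt (d := d) hpdeg (ofFn_degree_lt v)
  set q := (X ^ (d + 1) + (C (y1 / (2 * s)) * X + C s)) ^ 2 - ofFn (d + 1) v with hq
  have hdvd : X ^ 2 ∣ q := by
    have e : q = X ^ 2 * (X ^ (2 * d) + C (2 * (y1 / (2 * s))) * X ^ d + C ((y1 / (2 * s)) ^ 2)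
        + C (2 * s) * X ^ (d - 1)) + (C y1 * X + C y0 - ofFn (d + 1) v) := by
      have e0 : y1 = 2 * (y1 / (2 * s)) * s :=
        (div_mul_cancel₀ y1 (mul_ne_zero h2E hs0)).symm.trans (by ring)
      have e1 : C y1 = 2 * C (y1 / (2 * s)) * C s :=
        (congrArg C e0).trans (by simp only [C_mul, map_ofNat])
      have e2 : (X : E[X]) ^ (d + 1) = X ^ (d - 1) * X ^ 2 := by rw [← pow_add]; congr 1; omega
      have e3 : (X : E[X]) ^ (2 * d) = X ^ (d - 1) * X ^ (d - 1) * X ^ 2 := by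
        rw [← pow_add, ← pow_add]; congr 1; omega
      have e4 : (X : E[X]) ^ d = X ^ (d - 1) * X := by rw [← pow_succ]; congr 1; omega
      rw [hq, e1, ← hs, e2, e3, e4]
      simp only [C_mul, C_pow, map_ofNat]
      ring
    rw [e]
    refine dvd_add (dvd_mul_right _ _) (X_pow_dvd_iff.mpr fun i hi => ?_)
    interval_cases i
    · simp [ofFn_coeff_eq_val_of_lt v (show 0 < d + 1 by omega), y0]
    · simp [ofFn_coeff_eq_val_of_lt v (show 1 < d + 1 by omega), y1, coeff_C]
  obtain ⟨p, hp⟩ := hdvd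
  have hpm : p.Monic := (monic_X_pow 2).of_mul_monic_left (hp ▸ H'.monic_left.1)
  have hpd : p.natDegree = 2 * d := by
    have := H'.monic_left.2
    rw [hp, (monic_X_pow 2).natDegree_mul hpm, natDegree_X_pow] at this
    omega
  have hba : b ∈ Finset.univ.erase a := by simp [hab.symm]
  obtain ⟨r, hr⟩ := exists_prod_X_sub_C_eq ((Finset.univ.erase a).erase b) p hpm (by
    rw [hpd, Finset.card_erase_of_mem hba, Finset.card_erase_of_mem (Finset.mem_univ a),
      Finset.card_univ, hι]; rfl)
  let r' : ι → E := fun i => if i = a ∨ i = b then 0 else r i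
  have hr' : ∏ i, (X - C (r' i)) = q := by
    rw [← Finset.mul_prod_erase _ _ (Finset.mem_univ a), ← Finset.mul_prod_erase _ _ hba, hp, ← hr]
    have : ∏ k ∈ (Finset.univ.erase a).erase b, (X - C (r' k)) =
        ∏ k ∈ (Finset.univ.erase a).erase b, (X - C (r k)) :=
      Finset.prod_congr rfl fun k hk => by
        simp only [Finset.mem_erase, Finset.mem_univ, and_true] at hk
        simp [r', hk.1, hk.2]
    rw [this]
    simp only [r', true_or, or_true, if_true, C_0, sub_zero]
    ring
  rw [← hr'] at H'
  obtain ⟨φ, -, hφl, hφr⟩ := H.exists_specialization h2E r' H'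
  refine ⟨E, inferInstance, inferInstance, φ, ?_, ?_, ?_⟩
  · exact pow_eq_zero_iff two_ne_zero |>.mp ((hφr a).trans (by simp [r']))
  · exact pow_eq_zero_iff two_ne_zero |>.mp ((hφr b).trans (by simp [r']))
  · convert! hv using 1
    ext i
    have := congr_arg (coeff · (i : ℕ)) hφl
    simpa [ofFn_coeff_eq_val_of_lt _ i.2] using this

/-- In a purely transcendental extension, the base field is algebraically closed. -/
theorem AlgebraicIndependent.mem_range_algebraMap_of_isAlgebraic {F E ι : Type*} [Field F]
    [Field E] [Algebra F E] {v : ι → E} (hv : AlgebraicIndependent F v) {x : E}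
    (hx : IsAlgebraic F x) (hmem : x ∈ IntermediateField.adjoin F (Set.range v)) :
    ∃ c : F, algebraMap F E c = x := by
  obtain ⟨r, s, hrs⟩ := (IntermediateField.mem_adjoin_range_iff F v x).mp hmem
  by_cases hs : s = 0
  · exact ⟨0, by simp [hrs, hs]⟩
  have hs' : MvPolynomial.aeval v s ≠ 0 := fun h0 => hs ((injective_iff_map_eq_zero _).mp hv _ h0)
  rw [eq_div_iff hs'] at hrs
  let L := algebraicClosure F E
  let x' : L := ⟨x, mem_algebraicClosure_iff.mpr hx⟩
  have hvL : AlgebraicIndependent L v := hv.algebraicClosure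
  have e : MvPolynomial.C x' * MvPolynomial.map (algebraMap F L) s
      = MvPolynomial.map (algebraMap F L) r := by
    apply hvL
    rw [map_mul, MvPolynomial.aeval_map_algebraMap, MvPolynomial.aeval_map_algebraMap, ← hrs]
    simp [x']
  obtain ⟨i, hi⟩ := MvPolynomial.ne_zero_iff.mp hs
  have hc := congr_arg (fun p => algebraMap L E (MvPolynomial.coeff i p)) e
  simp only [MvPolynomial.coeff_C_mul, MvPolynomial.coeff_map, map_mul] at hc
  rw [← IsScalarTower.algebraMap_apply, ← IsScalarTower.algebraMap_apply] at hc
  refine ⟨r.coeff i / s.coeff i, ?_⟩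
  rw [map_div₀, div_eq_iff (by simpa using hi), ← hc]
  rfl

section Invariance

variable {K A Kt E κ : Type*} [Field K] [CommRing A] [Algebra K A] [Field Kt] [Algebra A Kt]
  [Field E] [Algebra K E] {φ : A →ₐ[K] E} {v : κ → A}

theorem IsAlgebraic.of_adjoin_range_algebraMap [Algebra K Kt] [IsScalarTower K A Kt] {x : Kt}
    (hx : IsAlgebraic (IntermediateField.adjoin K (Set.range fun i => algebraMap A Kt (v i))) x) :
    IsAlgebraic (Algebra.adjoin K (Set.range v)) x := by
  rw [IntermediateField.isAlgebraic_adjoin_iff] at hx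
  have hle : (Algebra.adjoin K (Set.range v)).map (IsScalarTower.toAlgHom K A Kt) =
      Algebra.adjoin K (Set.range fun i => algebraMap A Kt (v i)) := by
    rw [AlgHom.map_adjoin, ← Set.range_comp]; rfl
  rw [← hle] at hx
  let f := (IsScalarTower.toAlgHom K A Kt).subalgebraMap (Algebra.adjoin K (Set.range v))
  exact IsAlgebraic.of_ringHom_of_comp_eq (g := RingHom.id Kt) f hx
    (AlgHom.subalgebraMap_surjective _ _) Function.injective_id rfl

theorem map_ne_zero_of_mem_adjoin (hφ : AlgebraicIndependent K fun i => φ (v i)) {c : A}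
    (hc : c ∈ Algebra.adjoin K (Set.range v)) (hc0 : c ≠ 0) : φ c ≠ 0 := by
  rw [Algebra.adjoin_range_eq_range_aeval] at hc
  obtain ⟨p, rfl⟩ := hc
  intro h0
  apply hc0
  have h1 : MvPolynomial.aeval (fun i => φ (v i)) p = 0 := by
    rw [← h0]
    exact (DFunLike.congr_fun (MvPolynomial.comp_aeval v φ) p).symm
  rw [(injective_iff_map_eq_zero _).mp hφ _ h1]
  exact map_zero _

variable [IsDomain A] [UniqueFactorizationMonoid A] [IsFractionRing A Kt]

theorem map_den_ne_zero (hφ : AlgebraicIndependent K fun i => φ (v i)) {x : Kt}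
    (hx : IsAlgebraic (Algebra.adjoin K (Set.range v)) x) :
    φ (IsFractionRing.den A x : A) ≠ 0 := by
  obtain ⟨p, hp0, hp⟩ := hx
  have hp' : aeval x (p.map (algebraMap (Algebra.adjoin K (Set.range v)) A)) = 0 := by
    rw [aeval_map_algebraMap, hp]
  obtain ⟨c, hc⟩ := den_dvd_of_is_root hp'
  rw [leadingCoeff_map_of_injective Subtype.val_injective] at hc
  have h1 := map_ne_zero_of_mem_adjoin hφ p.leadingCoeff.2 (by simpa using hp0)
  intro h0
  apply h1
  have := congr_arg φ hc
  rwa [map_mul, h0, zero_mul] at this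

theorem map_num_ne_zero (hφ : AlgebraicIndependent K fun i => φ (v i)) {x : Kt}
    (hx : IsAlgebraic (Algebra.adjoin K (Set.range v)) x) (hx0 : x ≠ 0) :
    φ (IsFractionRing.num A x) ≠ 0 := by
  obtain ⟨p, hp0, hp⟩ := hx.exists_nonzero_coeff_and_aeval_eq_zero
    (mem_nonZeroDivisors_of_ne_zero hx0)
  have hp' : aeval x (p.map (algebraMap (Algebra.adjoin K (Set.range v)) A)) = 0 := by
    rw [aeval_map_algebraMap, hp]
  obtain ⟨c, hc⟩ := num_dvd_of_is_root hp'
  rw [coeff_map] at hc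
  have h1 := map_ne_zero_of_mem_adjoin hφ (p.coeff 0).2 (by simpa using hp0)
  intro h0
  apply h1
  have := congr_arg φ hc
  rwa [map_mul, h0, zero_mul] at this

/-- Let `σ` be an automorphism fixing the `v i` and acting trivially modulo `ker φ` (it is inertial
at `ker φ`). If the `φ (v i)` are algebraically independent, then `σ` fixes every element of the
fraction field that is algebraic over `K(v)`. -/
theorem fixed_of_isAlgebraic_of_inertial [Algebra K Kt] [IsScalarTower K A Kt]
    (hφ : AlgebraicIndependent K fun i => φ (v i))
    (σ : A →ₐ[K] A) (hσφ : ∀ a, φ (σ a) = φ a) (σ' : Kt ≃ₐ[K] Kt)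
    (hσ' : ∀ a, σ' (algebraMap A Kt a) = algebraMap A Kt (σ a)) (hσv : ∀ i, σ (v i) = v i)
    {x : Kt}
    (hx : IsAlgebraic (IntermediateField.adjoin K (Set.range fun i => algebraMap A Kt (v i))) x) :
    σ' x = x := by
  set F := IntermediateField.adjoin K (Set.range fun i => algebraMap A Kt (v i)) with hF
  have hfix : ∀ c ∈ F, σ' c = c := by
    intro c hc
    induction hc using IntermediateField.adjoin_induction with
    | mem y hy => obtain ⟨i, rfl⟩ := hy; simp [hσ', hσv]
    | algebraMap y => exact σ'.commutes y
    | add y z _ _ h1 h2 => rw [map_add, h1, h2]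
    | inv y _ h1 => rw [map_inv₀, h1]
    | mul y z _ _ h1 h2 => rw [map_mul, h1, h2]
  have hσx : IsAlgebraic F (σ' x) := by
    refine hx.ringHom_of_comp_eq (RingHom.id F) σ' Function.injective_id ?_
    ext c
    exact (hfix c c.2).symm
  have hy : IsAlgebraic F (σ' x - x) := hσx.sub hx
  by_contra hne
  apply map_num_ne_zero hφ hy.of_adjoin_range_algebraMap (sub_ne_zero.mpr hne)
  have hden := map_den_ne_zero hφ hx.of_adjoin_range_algebraMap
  set a := IsFractionRing.num A x
  set b : A := (IsFractionRing.den A x : A)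
  set y := σ' x - x with hy
  set a' := IsFractionRing.num A y
  set b' : A := (IsFractionRing.den A y : A)
  have hb : algebraMap A Kt b ≠ 0 := by
    rw [Ne, FaithfulSMul.algebraMap_eq_zero_iff]; rintro h0; exact hden (by rw [h0, map_zero])
  have hb' : algebraMap A Kt b' ≠ 0 := by
    rw [Ne, FaithfulSMul.algebraMap_eq_zero_iff]; exact nonZeroDivisors.coe_ne_zero _
  have hσb : algebraMap A Kt (σ b) ≠ 0 := by rw [← hσ']; simpa using hb
  have hxab : x = algebraMap A Kt a / algebraMap A Kt b := (IsFractionRing.mk'_num_den' A x).symm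
  have hyab : y = algebraMap A Kt a' / algebraMap A Kt b' := (IsFractionRing.mk'_num_den' A y).symm
  have e : a' * (b * σ b) = (σ a * b - a * σ b) * b' := by
    apply IsFractionRing.injective A Kt
    rw [hxab, hyab, map_div₀, hσ', hσ'] at hy
    field_simp at hy
    simp only [map_mul, map_sub]
    linear_combination hy
  have e' := congr_arg φ e
  simp only [map_mul, map_sub, hσφ, sub_self, zero_mul] at e'
  simpa [hden] using e'

end Invariance

section SquareRoots

variable {k L ι : Type*} [Field k] [Field L] [Algebra k L] [Fintype ι] {t : ι → L} {m : k[X]}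

/-- A field generated by square roots `t i` of the distinct nonzero roots of a polynomial is a
splitting field, hence finite Galois, in characteristic different from two. -/
theorem isGalois_of_adjoin_sqrt_roots (h2 : (2 : k) ≠ 0)
    (hm : m.map (algebraMap k L) = ∏ i, (X - C (t i ^ 2)))
    (hinj : Function.Injective fun i => t i ^ 2) (ht : ∀ i, t i ≠ 0)
    (hgen : IntermediateField.adjoin k (Set.range t) = ⊤) :
    IsGalois k L ∧ FiniteDimensional k L := by
  have hp : (m.comp (X ^ 2)).map (algebraMap k L) = ∏ i, (X ^ 2 - C (t i ^ 2)) := by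
    simp [map_comp, hm, prod_comp]
  have hm0 : m.comp (X ^ 2) ≠ 0 := by
    intro h0
    rw [h0, Polynomial.map_zero] at hp
    exact Finset.prod_ne_zero_iff.mpr
      (fun i _ => X_pow_sub_C_ne_zero two_pos (t i ^ 2)) hp.symm
  have hsep : (m.comp (X ^ 2)).Separable := by
    rw [← separable_map (algebraMap k L), hp]
    refine separable_prod (fun i j hij => ?_) fun i => ?_
    · have hne : t j ^ 2 - t i ^ 2 ≠ 0 := sub_ne_zero.mpr fun h0 => hij (hinj h0).symm
      refine ⟨C (t j ^ 2 - t i ^ 2)⁻¹, -C (t j ^ 2 - t i ^ 2)⁻¹, ?_⟩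
      have e : C (t j ^ 2 - t i ^ 2)⁻¹ * (C (t j ^ 2) - C (t i ^ 2)) = 1 := by
        rw [← C_sub, ← C_mul, inv_mul_cancel₀ hne, C_1]
      linear_combination e
    · refine separable_X_pow_sub_C _ ?_ (pow_ne_zero 2 (ht i))
      rw [← map_natCast (algebraMap k L)]
      exact (_root_.map_ne_zero _).mpr (by exact_mod_cast h2)
  have hsplit : IsSplittingField k L (m.comp (X ^ 2)) := by
    rw [isSplittingField_iff_intermediateField]
    refine ⟨?_, top_le_iff.mp (hgen.symm.le.trans (IntermediateField.adjoin.mono _ _ _ ?_))⟩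
    · rw [hp]
      refine Splits.prod fun i _ => ?_
      rw [C_pow, sq_sub_sq]
      exact (Splits.X_add_C _).mul (Splits.X_sub_C _)
    · rintro _ ⟨i, rfl⟩
      rw [mem_rootSet]
      refine ⟨hm0, ?_⟩
      rw [← eval_map_algebraMap, hp, eval_prod]
      exact Finset.prod_eq_zero (Finset.mem_univ i) (by simp)
  exact ⟨IsGalois.of_separable_splitting_field hsep,
    IsSplittingField.finiteDimensional L (m.comp (X ^ 2))⟩

/-- An automorphism permutes the square roots of the roots of a polynomial up to sign. -/
theorem exists_perm_eq_or_eq_neg (hm : m.map (algebraMap k L) = ∏ i, (X - C (t i ^ 2)))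
    (hinj : Function.Injective fun i => t i ^ 2) (τ : L ≃ₐ[k] L) :
    ∃ π : Equiv.Perm ι, ∀ i, τ (t i) = t (π i) ∨ τ (t i) = -t (π i) := by
  have h1 : ∀ i, ∃ j, τ (t i) ^ 2 = t j ^ 2 := by
    intro i
    have hr : aeval (t i ^ 2) m = 0 := by
      rw [← eval_map_algebraMap, hm, eval_prod]
      exact Finset.prod_eq_zero (Finset.mem_univ i) (by simp)
    have hr' : aeval (τ (t i ^ 2)) m = 0 := by
      rw [aeval_algHom_apply, hr, map_zero]
    rw [← eval_map_algebraMap, hm, eval_prod, Finset.prod_eq_zero_iff] at hr'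
    obtain ⟨j, -, hj⟩ := hr'
    exact ⟨j, by simpa [sub_eq_zero] using hj⟩
  choose π hπ using h1
  have hπi : Function.Injective π := by
    intro i j hij
    apply hinj
    apply τ.injective
    simp only [map_pow, hπ, hij]
  refine ⟨Equiv.ofBijective π (Finite.injective_iff_bijective.mp hπi), fun i => ?_⟩
  exact sq_eq_sq_iff_eq_or_eq_neg.mp (hπ i)

/-- A subgroup of automorphisms containing all transpositions and sign changes of a generating
family contains every automorphism permuting that family up to sign. -/
theorem mem_subgroup_of_perm_up_to_sign [DecidableEq ι]
    (hgen : IntermediateField.adjoin k (Set.range t) = ⊤) (S : Subgroup (L ≃ₐ[k] L))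
    (hswap : ∀ a b, a ≠ b → ∃ σ ∈ S, ∀ i, σ (t i) = t (Equiv.swap a b i))
    (hsign : ∀ a, ∃ σ ∈ S, ∀ i, σ (t i) = if i = a then -t i else t i)
    (τ : L ≃ₐ[k] L) (π : Equiv.Perm ι) (hτ : ∀ i, τ (t i) = t (π i) ∨ τ (t i) = -t (π i)) :
    τ ∈ S := by
  classical
  have hperm : ∃ σ ∈ S, ∀ i, σ (t i) = t (π i) := by
    clear hτ
    induction π using Equiv.Perm.swap_induction_on with
    | one => exact ⟨1, S.one_mem, fun i => rfl⟩
    | swap_mul f a b hab ih =>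
      obtain ⟨σ, hσ, hσt⟩ := ih
      obtain ⟨ρ, hρ, hρt⟩ := hswap a b hab
      exact ⟨ρ * σ, S.mul_mem hρ hσ, fun i => by simp [hσt, hρt]⟩
  have hsigns : ∀ s : Finset ι, ∃ σ ∈ S, ∀ i, σ (t i) = if i ∈ s then -t i else t i := by
    intro s
    induction s using Finset.induction_on with
    | empty => exact ⟨1, S.one_mem, fun i => by simp⟩
    | insert a s ha ih =>
      obtain ⟨σ, hσ, hσt⟩ := ih
      obtain ⟨ρ, hρ, hρt⟩ := hsign a
      refine ⟨ρ * σ, S.mul_mem hρ hσ, fun i => ?_⟩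
      rw [AlgEquiv.mul_apply, hσt]
      by_cases hi : i = a
      · subst hi; simp [ha, hρt]
      · by_cases his : i ∈ s <;> simp [hi, his, hρt]
  obtain ⟨σ, hσ, hσt⟩ := hperm
  obtain ⟨ρ, hρ, hρt⟩ := hsigns {i | τ (t i) ≠ t (π i)}
  have key : τ = σ * ρ := by
    ext x
    have hx : x ∈ IntermediateField.adjoin k (Set.range t) := hgen ▸ IntermediateField.mem_top
    induction hx using IntermediateField.adjoin_induction with
    | mem y hy =>
      obtain ⟨i, rfl⟩ := hy
      rw [AlgEquiv.mul_apply, hρt]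
      by_cases hi : τ (t i) = t (π i)
      · rw [if_neg (by simpa using hi), hσt, hi]
      · rw [if_pos (by simpa using hi), map_neg, hσt, (hτ i).resolve_left hi]
    | algebraMap y => rw [AlgEquiv.commutes, AlgEquiv.commutes]
    | add y z _ _ h1 h2 => rw [map_add, map_add, h1, h2]
    | inv y _ h1 => rw [map_inv₀, map_inv₀, h1]
    | mul y z _ _ h1 h2 => rw [map_mul, map_mul, h1, h2]
  rw [key]
  exact S.mul_mem hσ hρ

end SquareRoots

open Classical in
/-- The involution of the polynomial ring changing the sign of one variable. -/
noncomputable def signChange (K : Type*) [Field K] {ι : Type*} (a : ι) :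
    MvPolynomial ι K ≃ₐ[K] MvPolynomial ι K :=
  let f : MvPolynomial ι K →ₐ[K] MvPolynomial ι K :=
    MvPolynomial.aeval fun i => if i = a then -MvPolynomial.X i else MvPolynomial.X i
  have hf : f.comp f = AlgHom.id K _ := by
    ext i : 1
    by_cases hi : i = a <;> simp [f, hi]
  AlgEquiv.ofAlgHom f f hf hf

open Classical in
theorem signChange_X {K ι : Type*} [Field K] (a i : ι) : signChange K a (MvPolynomial.X i) =
    if i = a then -MvPolynomial.X i else MvPolynomial.X i :=
  MvPolynomial.aeval_X _ i

section GenericSquares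

variable {K Kt ι : Type*} [Field K] [Field Kt] [Algebra K Kt]
  [Algebra (MvPolynomial ι K) Kt] [IsScalarTower K (MvPolynomial ι K) Kt]
  [IsFractionRing (MvPolynomial ι K) Kt]

variable (Kt) in
theorem adjoin_range_algebraMap_X_eq_top (k : Type*) [Field k] [Algebra K k] [Algebra k Kt]
    [IsScalarTower K k Kt] :
    IntermediateField.adjoin k
      (Set.range fun i : ι => algebraMap (MvPolynomial ι K) Kt (MvPolynomial.X i)) = ⊤ := by
  refine eq_top_iff.mpr fun x _ => ?_
  set T := IntermediateField.adjoin k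
    (Set.range fun i : ι => algebraMap (MvPolynomial ι K) Kt (MvPolynomial.X i))
  have hA : ∀ a : MvPolynomial ι K, algebraMap (MvPolynomial ι K) Kt a ∈ T := by
    intro a
    induction a using MvPolynomial.induction_on with
    | C c =>
      rw [← MvPolynomial.algebraMap_eq, ← IsScalarTower.algebraMap_apply,
        IsScalarTower.algebraMap_apply K k Kt]
      exact T.algebraMap_mem _
    | add p q hp hq => rw [map_add]; exact T.add_mem hp hq
    | mul_X p i hp =>
      rw [map_mul]
      exact T.mul_mem hp (IntermediateField.subset_adjoin _ _ ⟨i, rfl⟩)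
  obtain ⟨a, b, -, rfl⟩ := IsFractionRing.div_surjective (MvPolynomial ι K) x
  exact T.div_mem (hA a) (hA b)

variable [Fintype ι] {d : ℕ} {h l : (MvPolynomial ι K)[X]}

/-- An automorphism of the polynomial ring preserving the generic polynomial `∏ i, (X - X i ^ 2)`
and inertial at two vanishing variables fixes every element algebraic over `K(l₀, …, l_d)`. -/
theorem IsSqrtPair.exists_fixes_of_inertial (h2 : (2 : K) ≠ 0) (hd : 1 ≤ d)
    (hι : Fintype.card ι = 2 * d + 2)
    (H : IsSqrtPair d (∏ i : ι, (X - C (MvPolynomial.X i ^ 2))) h l) {x : Kt}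
    (hx : IsAlgebraic (IntermediateField.adjoin K (Set.range fun i : Fin (d + 1) =>
      algebraMap (MvPolynomial ι K) Kt (l.coeff (i : ℕ)))) x)
    (σ : MvPolynomial ι K ≃ₐ[K] MvPolynomial ι K) (s : Equiv.Perm ι)
    (hσ2 : ∀ i, σ (MvPolynomial.X i) ^ 2 = MvPolynomial.X (s i) ^ 2)
    {a b : ι} (hab : a ≠ b)
    (hσab : ∀ i, σ (MvPolynomial.X i) - MvPolynomial.X i ∈
      Ideal.span {(MvPolynomial.X a : MvPolynomial ι K), MvPolynomial.X b}) :
    ∃ σ' ∈ MulAction.stabilizer (Kt ≃ₐ[K] Kt) x,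
      ∀ p, σ' (algebraMap (MvPolynomial ι K) Kt p) = algebraMap (MvPolynomial ι K) Kt (σ p) := by
  obtain ⟨E, _, _, φ, hφa, hφb, hφ⟩ := H.exists_specialization_eq_zero h2 hd hι a b hab
  have hσφ : ∀ p, φ (σ p) = φ p := by
    have : φ.comp (σ : MvPolynomial ι K →ₐ[K] MvPolynomial ι K) = φ := by
      refine MvPolynomial.algHom_ext fun i => ?_
      have hle : Ideal.span {(MvPolynomial.X a : MvPolynomial ι K), MvPolynomial.X b} ≤
          RingHom.ker φ := by
        rw [Ideal.span_le]
        rintro _ (rfl | rfl)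
        · exact hφa
        · exact hφb
      have := hle (hσab i)
      rw [RingHom.mem_ker, map_sub, sub_eq_zero] at this
      exact this
    exact fun p => DFunLike.congr_fun this p
  have hσl : ∀ i : Fin (d + 1), (σ : MvPolynomial ι K →ₐ[K] MvPolynomial ι K) (l.coeff (i : ℕ)) =
      l.coeff (i : ℕ) := by
    have H' := H.map (σ : MvPolynomial ι K →+* MvPolynomial ι K)
    have e : (∏ i : ι, (X - C (MvPolynomial.X i ^ 2 : MvPolynomial ι K))).map
        (σ : MvPolynomial ι K →+* MvPolynomial ι K) = ∏ i : ι, (X - C (MvPolynomial.X i ^ 2)) := by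
      refine Eq.trans ?_ (Equiv.prod_comp s fun i => (X - C (MvPolynomial.X i ^ 2)))
      simp [Polynomial.map_prod, ← hσ2]
    rw [e] at H'
    have h2A : (2 : MvPolynomial ι K) ≠ 0 := by
      rw [← map_ofNat (MvPolynomial.C (σ := ι) (R := K)) 2]
      exact MvPolynomial.C_ne_zero.mpr h2
    have hl := (H'.unique h2A H).2
    intro i
    simpa using congr_arg (coeff · (i : ℕ)) hl
  let σ' : Kt ≃ₐ[K] Kt := IsFractionRing.fieldEquivOfAlgEquiv K Kt Kt σ
  have hσ' : ∀ p, σ' (algebraMap (MvPolynomial ι K) Kt p) =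
      algebraMap (MvPolynomial ι K) Kt (σ p) :=
    IsFractionRing.fieldEquivOfAlgEquiv_algebraMap K Kt Kt σ
  exact ⟨σ', fixed_of_isAlgebraic_of_inertial hφ (σ : MvPolynomial ι K →ₐ[K] MvPolynomial ι K)
    hσφ σ' hσ' hσl hx, hσ'⟩

open Classical in
/-- Every element algebraic over `K(l₀, …, l_d)` lies in `K(l₀, …, l_d)(h₀, …, h_d)`. -/
theorem IsSqrtPair.mem_adjoin_coeff_of_isAlgebraic (h2 : (2 : K) ≠ 0) (hd : 1 ≤ d)
    (hι : Fintype.card ι = 2 * d + 2)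
    (H : IsSqrtPair d (∏ i : ι, (X - C (MvPolynomial.X i ^ 2))) h l) {x : Kt}
    (hx : IsAlgebraic (IntermediateField.adjoin K (Set.range fun i : Fin (d + 1) =>
      algebraMap (MvPolynomial ι K) Kt (l.coeff (i : ℕ)))) x) :
    x ∈ IntermediateField.adjoin (IntermediateField.adjoin K (Set.range fun i : Fin (d + 1) =>
      algebraMap (MvPolynomial ι K) Kt (l.coeff (i : ℕ))))
      (Set.range fun i : Fin (d + 1) => algebraMap (MvPolynomial ι K) Kt (h.coeff (i : ℕ))) := by
  set F := IntermediateField.adjoin K (Set.range fun i : Fin (d + 1) =>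
      algebraMap (MvPolynomial ι K) Kt (l.coeff (i : ℕ))) with hF
  set E := IntermediateField.adjoin F
      (Set.range fun i : Fin (d + 1) => algebraMap (MvPolynomial ι K) Kt (h.coeff (i : ℕ))) with hE
  have hl : ∃ q : E[X], q.map (algebraMap E Kt) = l.map (algebraMap (MvPolynomial ι K) Kt) := by
    rw [← mem_lifts, lifts_iff_coeff_lifts]
    intro i
    rw [coeff_map]
    by_cases hi : i < d + 1
    · exact ⟨algebraMap F E ⟨_, IntermediateField.subset_adjoin K _ ⟨⟨i, hi⟩, rfl⟩⟩, rfl⟩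
    · have h0 : l.coeff i = 0 := coeff_eq_zero_of_degree_lt
        (H.degree_le.trans_lt (by exact_mod_cast Nat.lt_of_succ_le (not_lt.mp hi)))
      exact ⟨0, by simp [h0]⟩
  have hh : ∃ q : E[X], q.map (algebraMap E Kt) = h.map (algebraMap (MvPolynomial ι K) Kt) := by
    rw [← mem_lifts, lifts_iff_coeff_lifts]
    intro i
    rw [coeff_map]
    rcases lt_trichotomy i (d + 1) with hi | rfl | hi
    · exact ⟨⟨_, IntermediateField.subset_adjoin F _ ⟨⟨i, hi⟩, rfl⟩⟩, rfl⟩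
    · exact ⟨1, by rw [← H.natDegree_eq, H.monic.coeff_natDegree, map_one, map_one]⟩
    · exact ⟨0, by simp [coeff_eq_zero_of_natDegree_lt (H.natDegree_eq.trans_lt hi)]⟩
  obtain ⟨lE, hlE⟩ := hl
  obtain ⟨hE', hhE⟩ := hh
  have hm : (hE' ^ 2 - lE).map (algebraMap E Kt) =
      ∏ i : ι, (X - C (algebraMap (MvPolynomial ι K) Kt (MvPolynomial.X i) ^ 2)) := by
    rw [Polynomial.map_sub, Polynomial.map_pow, hlE, hhE, ← Polynomial.map_pow,
      ← Polynomial.map_sub, ← H.eq]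
    simp [Polynomial.map_prod]
  have hinjA := IsFractionRing.injective (MvPolynomial ι K) Kt
  have hinj : Function.Injective fun i : ι =>
      algebraMap (MvPolynomial ι K) Kt (MvPolynomial.X i) ^ 2 := by
    intro i j hij
    have hij' : (MvPolynomial.X i : MvPolynomial ι K) ^ 2 = MvPolynomial.X j ^ 2 :=
      hinjA (by simpa using hij)
    by_contra hne
    simpa [hne] using congr_arg (MvPolynomial.eval (Pi.single i (1 : K))) hij'
  have h2E : (2 : E) ≠ 0 := by
    rw [← map_ofNat (algebraMap K E) 2]
    exact (_root_.map_ne_zero (algebraMap K E)).mpr h2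
  have : IsScalarTower K E Kt := IsScalarTower.of_algebraMap_eq fun _ => rfl
  obtain ⟨_, _⟩ := isGalois_of_adjoin_sqrt_roots h2E hm hinj
    (fun i => (map_ne_zero_iff _ hinjA).mpr (MvPolynomial.X_ne_zero i))
    (adjoin_range_algebraMap_X_eq_top (K := K) Kt E)
  have hfix : x ∈ (⊥ : IntermediateField E Kt) := by
    refine (IsGalois.mem_bot_iff_fixed x).mpr fun f => ?_
    obtain ⟨π, hπ⟩ := exists_perm_eq_or_eq_neg hm hinj f
    refine mem_subgroup_of_perm_up_to_sign (adjoin_range_algebraMap_X_eq_top (K := K) Kt K)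
      (MulAction.stabilizer (Kt ≃ₐ[K] Kt) x) (fun a b hab => ?_) (fun a => ?_)
      (f.restrictScalars K) π hπ
    · obtain ⟨σ, hσ, hσX⟩ := H.exists_fixes_of_inertial h2 hd hι hx
        (MvPolynomial.renameEquiv K (Equiv.swap a b)) (Equiv.swap a b) (by simp) hab (fun i => by
          have ha : (MvPolynomial.X a : MvPolynomial ι K) ∈
              Ideal.span {(MvPolynomial.X a : MvPolynomial ι K), MvPolynomial.X b} :=
            Ideal.subset_span (by simp)
          have hb : (MvPolynomial.X b : MvPolynomial ι K) ∈
              Ideal.span {(MvPolynomial.X a : MvPolynomial ι K), MvPolynomial.X b} :=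
            Ideal.subset_span (by simp)
          rw [MvPolynomial.renameEquiv_apply, MvPolynomial.rename_X]
          rw [Equiv.swap_apply_def]
          split_ifs with hia hib
          · rw [hia]; exact sub_mem hb ha
          · rw [hib]; exact sub_mem ha hb
          · simp)
      exact ⟨σ, hσ, fun i => by simp [hσX]⟩
    · have : Nontrivial ι := Fintype.one_lt_card_iff_nontrivial.mp (by omega)
      obtain ⟨b, hb⟩ := exists_ne a
      obtain ⟨σ, hσ, hσX⟩ := H.exists_fixes_of_inertial h2 hd hι hx (signChange K a) 1
        (fun i => by rw [signChange_X]; split_ifs <;> simp) hb.symm (fun i => by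
          rw [signChange_X]
          split_ifs with hi
          · subst hi
            exact sub_mem (neg_mem (Ideal.subset_span (by simp))) (Ideal.subset_span (by simp))
          · simp)
      refine ⟨σ, hσ, fun i => ?_⟩
      rw [hσX, signChange_X]
      split_ifs <;> simp
  obtain ⟨y, rfl⟩ := IntermediateField.mem_bot.mp hfix
  exact y.2

end GenericSquares

/-- Let `K` be a field of characteristic different from `2`, `d ≥ 1`,
`n = 2d + 2`, and let `𝕂̃ = K(t₁,…,tₙ)` be the rational function field in `n` variables
over `K` (realized as a fraction field of `MvPolynomial (Fin n) K`). Let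
`m(x) = ∏ᵢ (x - tᵢ²)` and let `(h, ℓ)` be the unique pair with `h` monic of degree
`d + 1`, `deg ℓ ≤ d` and `m = h² - ℓ`, with coefficients `ℓ_0, …, ℓ_d`. Then the
subfield `K(ℓ_0,…,ℓ_d)` of `𝕂̃` is algebraically closed in `𝕂̃`: every element of `𝕂̃`
algebraic over `K(ℓ_0,…,ℓ_d)` already lies in it. -/
theorem statement_11 {K : Type*} [Field K] (h2 : (2 : K) ≠ 0) (d : ℕ) (hd : 1 ≤ d)
    (n : ℕ) (hn : n = 2 * d + 2)
    (Kt : Type*) [Field Kt] [Algebra K Kt] [Algebra (MvPolynomial (Fin n) K) Kt]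
    [IsScalarTower K (MvPolynomial (Fin n) K) Kt]
    [IsFractionRing (MvPolynomial (Fin n) K) Kt]
    (t : Fin n → Kt) (ht : ∀ i, t i = algebraMap (MvPolynomial (Fin n) K) Kt (MvPolynomial.X i))
    (m : Polynomial Kt) (hm : m = ∏ i, (X - C (t i ^ 2)))
    (h l : Polynomial Kt) (hmon : h.Monic) (hhdeg : h.natDegree = d + 1)
    (hldeg : l.degree ≤ (d : WithBot ℕ)) (hhl : m = h ^ 2 - l)
    (F : IntermediateField K Kt)
    (hF : F = IntermediateField.adjoin K
      (Set.range fun i : Fin (d + 1) => l.coeff (i : ℕ))) :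
    ∀ x : Kt, IsAlgebraic ↥F x → x ∈ F := by
  intro x hx
  have hι : Fintype.card (Fin n) = 2 * d + 2 := by rw [Fintype.card_fin, hn]
  have hA2 : IsUnit (2 : MvPolynomial (Fin n) K) := by
    rw [← map_ofNat (MvPolynomial.C (σ := Fin n) (R := K)) 2]
    exact (isUnit_iff_ne_zero.mpr h2).map _
  have hinjA := IsFractionRing.injective (MvPolynomial (Fin n) K) Kt
  have h2t : (2 : Kt) ≠ 0 := by
    rw [← map_ofNat (algebraMap K Kt) 2]
    exact (_root_.map_ne_zero (algebraMap K Kt)).mpr h2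
  obtain ⟨h0, l0, H0⟩ := IsSqrtPair.exists_of_monic hA2 d
    (m := ∏ i : Fin n, (X - C (MvPolynomial.X i ^ 2 : MvPolynomial (Fin n) K)))
    (monic_prod_X_sub_C _ _) (by rw [natDegree_finsetProd_X_sub_C_eq_card]; simp [hn])
  have Ht := H0.map (algebraMap (MvPolynomial (Fin n) K) Kt)
  have hmt : (∏ i : Fin n, (X - C (MvPolynomial.X i ^ 2 : MvPolynomial (Fin n) K))).map
      (algebraMap (MvPolynomial (Fin n) K) Kt) = m := by
    simp [hm, Polynomial.map_prod, ht]
  rw [hmt] at Ht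
  obtain ⟨rfl, rfl⟩ := Ht.unique h2t ⟨hmon, hhdeg, hldeg, hhl⟩
  obtain rfl : t = fun i => algebraMap (MvPolynomial (Fin n) K) Kt (MvPolynomial.X i) := funext ht
  simp only [coeff_map] at hF
  have hind := (H0.algebraicIndependent_coeff h2 hι).map'
    (f := IsScalarTower.toAlgHom K (MvPolynomial (Fin n) K) Kt) hinjA
  rw [Sum.comp_elim, AlgebraicIndependent.sumElim_iff] at hind
  have hindF := IntermediateField.algebraicIndependent_adjoin_iff.mpr hind.2
  subst hF
  obtain ⟨c, rfl⟩ := hindF.mem_range_algebraMap_of_isAlgebraic hx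
    (H0.mem_adjoin_coeff_of_isAlgebraic h2 hd hι hx)
  exact c.2
end

section
/- Let K be a field of characteristic different from 2 and n ≥ 1. Let 𝕂̃ = K(t_1,…,t_n) be the rational function field in n variables over K, and let 𝕄 ⊆ 𝕂̃ be the subfield generated over K by the coefficients of the polynomial ∏_{i=1}^n (x − t_i^2) (equivalently, by the elementary symmetric polynomials in t_1^2,…,t_n^2). Then 𝕂̃/𝕄 is a finite Galois extension, every 𝕄-automorphism of 𝕂̃ is of the form t_i ↦ h_{g(i)} t_{g(i)} for a unique pair (h, g) ∈ {±1}^n × S_n, and the resulting correspondence identifies Gal(𝕂̃/𝕄) with the wreath product μ_2 ≀ S_n = {±1}^n ⋊ S_n (in particular [𝕂̃ : 𝕄] = 2^n · n!). -/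
open Polynomial

/-- The permutation action of `S_n` on `{±1}ⁿ`, `(g • h)(i) = h(g⁻¹ i)`, packaged as a
homomorphism to the automorphism group; the wreath product `μ₂ ≀ Sₙ` is the corresponding
semidirect product `(Fin n → ℤˣ) ⋊[permAut n] Equiv.Perm (Fin n)`. -/
def permAut (n : ℕ) : Equiv.Perm (Fin n) →* MulAut (Fin n → ℤˣ) where
  toFun g := MulEquiv.arrowCongr g (MulEquiv.refl ℤˣ)
  map_one' := by ext h i; rfl
  map_mul' g g' := by ext h i; rfl

namespace SignedPerm

section Action

variable {K : Type*} [CommRing K] {n : ℕ}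

/-- The wreath product `μ₂ ≀ Sₙ`. -/
abbrev Wreath (n : ℕ) : Type :=
  SemidirectProduct (Fin n → ℤˣ) (Equiv.Perm (Fin n)) (permAut n)

lemma permAut_apply (g : Equiv.Perm (Fin n)) (h : Fin n → ℤˣ) (i : Fin n) :
    permAut n g h (g i) = h i := by
  change h (g.symm (g i)) = h i
  rw [g.symm_apply_apply]

variable (K n) in
/-- The wreath product acts on polynomials by signed permutations of the variables. -/
noncomputable def polyEnd : Wreath n →* (MvPolynomial (Fin n) K →ₐ[K] MvPolynomial (Fin n) K) where
  toFun w := MvPolynomial.aeval fun i =>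
    ((w.left (w.right i) : ℤ) : MvPolynomial (Fin n) K) * MvPolynomial.X (w.right i)
  map_one' := by
    refine MvPolynomial.algHom_ext fun i => ?_
    simp
  map_mul' w w' := by
    refine MvPolynomial.algHom_ext fun i => ?_
    simp only [AlgHom.mul_apply, MvPolynomial.aeval_X, map_mul, map_intCast,
      SemidirectProduct.mul_left, SemidirectProduct.mul_right, Pi.mul_apply, Equiv.Perm.mul_apply,
      permAut_apply, Units.val_mul, Int.cast_mul]
    ring

@[simp] lemma polyEnd_X (w : Wreath n) (i : Fin n) :
    polyEnd K n w (MvPolynomial.X i) =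
      ((w.left (w.right i) : ℤ) : MvPolynomial (Fin n) K) * MvPolynomial.X (w.right i) :=
  MvPolynomial.aeval_X _ _

end Action

section RationalFunctions

variable {K : Type*} [Field K] {n : ℕ} {Kt : Type*} [Field Kt] [Algebra K Kt]
  [Algebra (MvPolynomial (Fin n) K) Kt] [IsScalarTower K (MvPolynomial (Fin n) K) Kt]
  [IsFractionRing (MvPolynomial (Fin n) K) Kt]

variable (K n Kt) in
/-- The action of the wreath product on rational functions by signed permutations. -/
noncomputable def fieldAut : Wreath n →* (Kt ≃ₐ[K] Kt) :=
  (IsFractionRing.fieldEquivOfAlgEquivHom (A := K) (B := MvPolynomial (Fin n) K) K Kt).comp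
    ((AlgEquiv.algHomUnitsEquiv K (MvPolynomial (Fin n) K)).toMonoidHom.comp
      (polyEnd K n).toHomUnits)

variable (K Kt) in
/-- The variable `tᵢ` as a rational function. -/
noncomputable abbrev var (i : Fin n) : Kt :=
  algebraMap (MvPolynomial (Fin n) K) Kt (MvPolynomial.X i)

lemma fieldAut_var (w : Wreath n) (i : Fin n) :
    fieldAut K n Kt w (var K Kt i) =
      ((w.left (w.right i) : ℤ) : Kt) * var K Kt (w.right i) := by
  have h : fieldAut K n Kt w (var K Kt i) =
      algebraMap (MvPolynomial (Fin n) K) Kt (polyEnd K n w (MvPolynomial.X i)) :=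
    IsFractionRing.fieldEquivOfAlgEquiv_algebraMap K Kt Kt _ _
  rw [h, polyEnd_X, map_mul, map_intCast]

lemma algEquiv_ext_var {M : IntermediateField K Kt} {φ ψ : Kt ≃ₐ[M] Kt}
    (h : ∀ i : Fin n, φ (var K Kt i) = ψ (var K Kt i)) : φ = ψ := by
  have hpoly : ((φ.restrictScalars K : Kt ≃ₐ[K] Kt) : Kt →ₐ[K] Kt).comp
        (IsScalarTower.toAlgHom K (MvPolynomial (Fin n) K) Kt) =
      ((ψ.restrictScalars K : Kt ≃ₐ[K] Kt) : Kt →ₐ[K] Kt).comp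
        (IsScalarTower.toAlgHom K (MvPolynomial (Fin n) K) Kt) :=
    MvPolynomial.algHom_ext h
  have hring : (φ : Kt →+* Kt) = (ψ : Kt →+* Kt) :=
    IsFractionRing.ringHom_ext (A := MvPolynomial (Fin n) K) fun p => DFunLike.congr_fun hpoly p
  exact AlgEquiv.ext fun x => DFunLike.congr_fun hring x

lemma adjoin_var : IntermediateField.adjoin K (Set.range (var K Kt : Fin n → Kt)) = ⊤ := by
  refine eq_top_iff.2 fun x _ => ?_
  have hmem (p : MvPolynomial (Fin n) K) : algebraMap _ Kt p ∈
      IntermediateField.adjoin K (Set.range (var K Kt : Fin n → Kt)) := by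
    induction p using MvPolynomial.induction_on with
    | C a =>
      rw [← MvPolynomial.algebraMap_eq, ← IsScalarTower.algebraMap_apply]
      exact IntermediateField.algebraMap_mem _ a
    | add p q hp hq => rw [map_add]; exact add_mem hp hq
    | mul_X p i hp =>
      rw [map_mul]
      exact mul_mem hp (IntermediateField.subset_adjoin _ _ ⟨i, rfl⟩)
  obtain ⟨a, b, -, rfl⟩ := IsFractionRing.div_surjective (A := MvPolynomial (Fin n) K) x
  exact div_mem (hmem a) (hmem b)

lemma adjoin_var_of_intermediateField (M : IntermediateField K Kt) :
    IntermediateField.adjoin M (Set.range (var K Kt : Fin n → Kt)) = ⊤ := by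
  refine IntermediateField.restrictScalars_injective K (eq_top_iff.2 ?_)
  rw [← adjoin_var (n := n), IntermediateField.adjoin_le_iff]
  exact IntermediateField.subset_adjoin M (Set.range (var K Kt : Fin n → Kt))

omit [Algebra K Kt] [IsScalarTower K (MvPolynomial (Fin n) K) Kt] in
lemma signed_var_injective (h2 : (2 : K) ≠ 0) :
    Function.Injective fun p : Fin n × ℤˣ => ((p.2 : ℤ) : Kt) * var K Kt p.1 := by
  rintro ⟨j, s⟩ ⟨k, s'⟩ h
  have hinj := IsFractionRing.injective (MvPolynomial (Fin n) K) Kt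
  have h' : ((s : ℤ) : MvPolynomial (Fin n) K) * MvPolynomial.X j =
      ((s' : ℤ) : MvPolynomial (Fin n) K) * MvPolynomial.X k := by
    apply hinj
    simpa only [map_mul, map_intCast] using h
  have hne : (2 : MvPolynomial (Fin n) K) ≠ 0 := by
    rw [← map_ofNat (MvPolynomial.C (σ := Fin n)) 2]
    simpa using h2
  have hjk : j = k := by
    by_contra hjk
    have := congrArg (MvPolynomial.aeval fun i => if i = j then (1 : K) else 0) h'
    simp only [map_mul, map_intCast, MvPolynomial.aeval_X, if_true, if_neg (Ne.symm hjk),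
      mul_one, mul_zero] at this
    rcases Int.units_eq_one_or s with rfl | rfl <;> simp at this
  subst hjk
  have hs := mul_right_cancel₀ (MvPolynomial.X_ne_zero j) h'
  rcases Int.units_eq_one_or s with rfl | rfl <;>
    rcases Int.units_eq_one_or s' with rfl | rfl
  · rfl
  · push_cast at hs
    exact absurd (by linear_combination hs) hne
  · push_cast at hs
    exact absurd (by linear_combination -hs) hne
  · rfl

variable (K n Kt) in
/-- The polynomial `∏ᵢ (x - tᵢ²)`. -/
noncomputable def sqPoly : Polynomial Kt := ∏ i : Fin n, (X - C (var K Kt i ^ 2))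

variable (K n Kt) in
/-- The subfield generated by the coefficients of `∏ᵢ (x - tᵢ²)`. -/
noncomputable abbrev coeffField : IntermediateField K Kt :=
  IntermediateField.adjoin K (Set.range (sqPoly K n Kt).coeff)

omit [Algebra K Kt] [IsScalarTower K (MvPolynomial (Fin n) K) Kt]
  [IsFractionRing (MvPolynomial (Fin n) K) Kt] in
lemma sqPoly_comp :
    (sqPoly K n Kt).comp (X ^ 2) =
      ∏ p : Fin n × ℤˣ, (X - C (((p.2 : ℤ) : Kt) * var K Kt p.1)) := by
  rw [sqPoly, Polynomial.prod_comp, Fintype.prod_prod_type]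
  refine Finset.prod_congr rfl fun i _ => ?_
  have : (Finset.univ : Finset ℤˣ) = {1, -1} := rfl
  rw [this, Finset.prod_pair (by decide)]
  simp
  ring

omit [IsScalarTower K (MvPolynomial (Fin n) K) Kt] [IsFractionRing (MvPolynomial (Fin n) K) Kt] in
variable (K n Kt) in
lemma exists_map_eq_prod_signed_var :
    ∃ P : Polynomial (coeffField K n Kt), P.map (algebraMap _ Kt) =
      ∏ p : Fin n × ℤˣ, (X - C (((p.2 : ℤ) : Kt) * var K Kt p.1)) := by
  obtain ⟨q, hq⟩ : ∃ q : Polynomial (coeffField K n Kt),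
      q.map (algebraMap _ Kt) = sqPoly K n Kt := by
    rw [← Polynomial.mem_lifts, Polynomial.lifts_iff_coeff_lifts]
    exact fun k => ⟨⟨_, IntermediateField.subset_adjoin _ _ ⟨k, rfl⟩⟩, rfl⟩
  exact ⟨q.comp (X ^ 2), by
    rw [Polynomial.map_comp, hq, Polynomial.map_pow, Polynomial.map_X, sqPoly_comp]⟩

lemma exists_isSplittingField (h2 : (2 : K) ≠ 0) :
    ∃ P : Polynomial (coeffField K n Kt),
      P.Separable ∧ P.IsSplittingField (coeffField K n Kt) Kt := by
  obtain ⟨P, hP⟩ := exists_map_eq_prod_signed_var K n Kt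
  have hsplits : (P.map (algebraMap _ Kt)).Splits := by
    rw [hP]
    exact Polynomial.Splits.prod fun p _ => Polynomial.Splits.X_sub_C _
  have hsep : P.Separable := by
    rw [← Polynomial.separable_map (algebraMap (coeffField K n Kt) Kt), hP,
      Polynomial.separable_prod_X_sub_C_iff]
    exact signed_var_injective h2
  refine ⟨P, hsep,
    isSplittingField_iff_intermediateField.2 ⟨hsplits, eq_top_iff.2 ?_⟩⟩
  rw [← adjoin_var_of_intermediateField (n := n)]
  refine IntermediateField.adjoin.mono _ _ _ ?_
  rintro _ ⟨i, rfl⟩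
  rw [Polynomial.mem_rootSet']
  refine ⟨hsep.map.ne_zero, ?_⟩
  rw [Polynomial.aeval_def, ← Polynomial.eval_map, hP, Polynomial.eval_prod]
  exact Finset.prod_eq_zero (Finset.mem_univ (i, 1)) (by simp)

lemma sign_mul_sq (s : ℤˣ) (x : Kt) : (((s : ℤ) : Kt) * x) ^ 2 = x ^ 2 := by
  rcases Int.units_eq_one_or s with rfl | rfl <;> simp

lemma fieldAut_mem_fixingSubgroup (w : Wreath n) :
    fieldAut K n Kt w ∈ (coeffField K n Kt).fixingSubgroup := by
  have hmap : (sqPoly K n Kt).map (fieldAut K n Kt w : Kt →+* Kt) = sqPoly K n Kt := by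
    simp only [sqPoly, Polynomial.map_prod, Polynomial.map_sub, Polynomial.map_X,
      Polynomial.map_C, RingHom.coe_coe, map_pow (fieldAut K n Kt w), fieldAut_var, sign_mul_sq]
    exact Equiv.prod_comp w.right fun i => X - C (var K Kt i ^ 2)
  rw [IntermediateField.mem_fixingSubgroup_iff]
  refine (IntermediateField.forall_mem_adjoin_smul_eq_self_iff K (fieldAut K n Kt w)).2 ?_
  rintro _ ⟨k, rfl⟩
  conv_rhs => rw [← hmap, Polynomial.coeff_map]
  rfl

variable (K n Kt) in
/-- The wreath product acts on rational functions by automorphisms over `coeffField`. -/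
noncomputable def galHom : Wreath n →* (Kt ≃ₐ[coeffField K n Kt] Kt) :=
  (IntermediateField.fixingSubgroupEquiv (coeffField K n Kt)).toMonoidHom.comp
    ((fieldAut K n Kt).codRestrict _ fieldAut_mem_fixingSubgroup)

lemma galHom_apply (w : Wreath n) (x : Kt) : galHom K n Kt w x = fieldAut K n Kt w x := rfl

lemma galHom_var (w : Wreath n) (i : Fin n) :
    galHom K n Kt w (var K Kt i) =
      ((w.left (w.right i) : ℤ) : Kt) * var K Kt (w.right i) := by
  rw [galHom_apply, fieldAut_var]

omit [Algebra K Kt] [IsScalarTower K (MvPolynomial (Fin n) K) Kt] in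
lemma signed_perm_unique (h2 : (2 : K) ≠ 0) {h h' : Fin n → ℤˣ} {g g' : Equiv.Perm (Fin n)}
    (H : ∀ i, ((h (g i) : ℤ) : Kt) * var K Kt (g i) =
      ((h' (g' i) : ℤ) : Kt) * var K Kt (g' i)) : h = h' ∧ g = g' := by
  have H' (i : Fin n) : (g i, h (g i)) = (g' i, h' (g' i)) :=
    signed_var_injective (Kt := Kt) h2 (H i)
  have hg : g = g' := Equiv.ext fun i => congrArg Prod.fst (H' i)
  subst hg
  refine ⟨funext fun j => ?_, rfl⟩
  simpa using congrArg Prod.snd (H' (g.symm j))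

lemma galHom_injective (h2 : (2 : K) ≠ 0) : Function.Injective (galHom K n Kt) := by
  intro w w' hw
  obtain ⟨hl, hr⟩ := signed_perm_unique (Kt := Kt) h2 (h := w.left) (h' := w'.left)
    (g := w.right) (g' := w'.right) fun i => by rw [← galHom_var, ← galHom_var, hw]
  exact SemidirectProduct.ext hl hr

omit [IsScalarTower K (MvPolynomial (Fin n) K) Kt] [IsFractionRing (MvPolynomial (Fin n) K) Kt] in
lemma exists_apply_var (φ : Kt ≃ₐ[coeffField K n Kt] Kt) (i : Fin n) :
    ∃ p : Fin n × ℤˣ, φ (var K Kt i) = ((p.2 : ℤ) : Kt) * var K Kt p.1 := by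
  obtain ⟨P, hP⟩ := exists_map_eq_prod_signed_var K n Kt
  have hroot : Polynomial.aeval (var K Kt i) P = 0 := by
    rw [Polynomial.aeval_def, ← Polynomial.eval_map, hP, Polynomial.eval_prod]
    exact Finset.prod_eq_zero (Finset.mem_univ (i, 1)) (by simp)
  have hroot' : Polynomial.aeval (φ (var K Kt i)) P = 0 := by
    rw [Polynomial.aeval_algEquiv, AlgHom.comp_apply, hroot, map_zero]
  rw [Polynomial.aeval_def, ← Polynomial.eval_map, hP, Polynomial.eval_prod,
    Finset.prod_eq_zero_iff] at hroot'
  obtain ⟨p, -, hp⟩ := hroot'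
  exact ⟨p, by simpa [sub_eq_zero] using hp⟩

lemma galHom_surjective (h2 : (2 : K) ≠ 0) : Function.Surjective (galHom K n Kt) := by
  intro φ
  choose p hp using exists_apply_var φ
  have hinj : Function.Injective fun i => (p i).1 := by
    intro i j hij
    have hsq : φ (var K Kt i ^ 2) = φ (var K Kt j ^ 2) := by
      rw [map_pow, map_pow, hp, hp, sign_mul_sq, sign_mul_sq, show (p i).1 = (p j).1 from hij]
    rcases sq_eq_sq_iff_eq_or_eq_neg.1 (φ.injective hsq) with h | h
    · exact congrArg Prod.fst (signed_var_injective (Kt := Kt) h2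
        (a₁ := (i, 1)) (a₂ := (j, 1)) (by simpa using h))
    · exact congrArg Prod.fst (signed_var_injective (Kt := Kt) h2
        (a₁ := (i, 1)) (a₂ := (j, -1)) (by simpa using h))
  let g : Equiv.Perm (Fin n) := Equiv.ofBijective _ (Finite.injective_iff_bijective.1 hinj)
  let w : Wreath n := ⟨fun j => (p (g.symm j)).2, g⟩
  have hvar (i : Fin n) : galHom K n Kt w (var K Kt i) = φ (var K Kt i) := by
    rw [galHom_var, hp]
    change (((p (g.symm (g i))).2 : ℤ) : Kt) * var K Kt (p i).1 = _
    rw [g.symm_apply_apply]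
  exact ⟨w, algEquiv_ext_var hvar⟩

end RationalFunctions

end SignedPerm

/-- Let `K` be a field of characteristic different from `2`, `n ≥ 1`,
`𝕂̃ = K(t₁,…,tₙ)` the rational function field in `n` variables over `K`, and `𝕄 ⊆ 𝕂̃`
the subfield generated over `K` by the coefficients of `∏ᵢ (x - tᵢ²)` (equivalently, by
the elementary symmetric polynomials in `t₁²,…,tₙ²`). Then `𝕂̃/𝕄` is finite Galois,
every `𝕄`-automorphism of `𝕂̃` is of the form `tᵢ ↦ h_{g(i)} t_{g(i)}` for a unique pair
`(h, g) ∈ {±1}ⁿ × Sₙ`, and the resulting correspondence identifies `Gal(𝕂̃/𝕄)` with the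
wreath product `μ₂ ≀ Sₙ = {±1}ⁿ ⋊ Sₙ`; in particular `[𝕂̃ : 𝕄] = 2ⁿ · n!`. -/
theorem statement_12 {K : Type*} [Field K] (h2 : (2 : K) ≠ 0) (n : ℕ) (hn : 1 ≤ n)
    (Kt : Type*) [Field Kt] [Algebra K Kt] [Algebra (MvPolynomial (Fin n) K) Kt]
    [IsScalarTower K (MvPolynomial (Fin n) K) Kt]
    [IsFractionRing (MvPolynomial (Fin n) K) Kt]
    (t : Fin n → Kt) (ht : ∀ i, t i = algebraMap (MvPolynomial (Fin n) K) Kt (MvPolynomial.X i))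
    (m : Polynomial Kt) (hm : m = ∏ i, (X - C (t i ^ 2)))
    (M : IntermediateField K Kt) (hM : M = IntermediateField.adjoin K (Set.range m.coeff)) :
    FiniteDimensional ↥M Kt ∧ IsGalois ↥M Kt ∧
      (∀ φ : Kt ≃ₐ[↥M] Kt, ∃! p : (Fin n → ℤˣ) × Equiv.Perm (Fin n),
        ∀ i, φ (t i) = (((p.1 (p.2 i) : ℤ) : Kt)) * t (p.2 i)) ∧
      (∃ e : (Kt ≃ₐ[↥M] Kt) ≃*
          SemidirectProduct (Fin n → ℤˣ) (Equiv.Perm (Fin n)) (permAut n),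
        ∀ (φ : Kt ≃ₐ[↥M] Kt) (i : Fin n),
          φ (t i) = ((((e φ).left ((e φ).right i) : ℤ) : Kt)) * t ((e φ).right i)) ∧
      Module.finrank ↥M Kt = 2 ^ n * n.factorial := by
  obtain rfl : t = SignedPerm.var K Kt := funext ht
  obtain rfl : m = SignedPerm.sqPoly K n Kt := hm
  obtain rfl : M = SignedPerm.coeffField K n Kt := hM
  obtain ⟨P, hPsep, hPsplit⟩ := SignedPerm.exists_isSplittingField (n := n) (Kt := Kt) h2
  have hfin : FiniteDimensional (SignedPerm.coeffField K n Kt) Kt :=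
    Polynomial.IsSplittingField.finiteDimensional Kt P
  have hgal : IsGalois (SignedPerm.coeffField K n Kt) Kt :=
    IsGalois.of_separable_splitting_field hPsep
  let e := (MulEquiv.ofBijective (SignedPerm.galHom K n Kt)
    ⟨SignedPerm.galHom_injective h2, SignedPerm.galHom_surjective h2⟩).symm
  have he (φ : Kt ≃ₐ[SignedPerm.coeffField K n Kt] Kt) (i : Fin n) :
      φ (SignedPerm.var K Kt i) =
        (((e φ).left ((e φ).right i) : ℤ) : Kt) * SignedPerm.var K Kt ((e φ).right i) := by
    rw [← SignedPerm.galHom_var]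
    exact congrArg (· (SignedPerm.var K Kt i)) (e.symm_apply_apply φ).symm
  refine ⟨hfin, hgal, fun φ => ⟨((e φ).left, (e φ).right), he φ, fun p hp => ?_⟩, ⟨e, he⟩, ?_⟩
  · obtain ⟨hl, hr⟩ := SignedPerm.signed_perm_unique (Kt := Kt) h2 fun i =>
      (hp i).symm.trans (he φ i)
    exact Prod.ext hl hr
  · rw [← IsGalois.card_aut_eq_finrank, Nat.card_congr e.toEquiv, SemidirectProduct.card]
    simp [Fintype.card_perm]
end

section
/- Let L/K be a finite Galois extension of fields, n ≥ 1. Let Ω = L_1 × ⋯ × L_r be a finite étale K-algebra of degree n split by L (i.e., Ω ⊗_K L ≅ L^n as L-algebras), and let Ω̃ be a quadratic extension of Ω split by L (i.e., Ω̃ = C_1 × ⋯ × C_r, where each C_i is either L_i × L_i or a separable quadratic field extension of L_i, and Ω̃ ⊗_K L ≅ L^{2n} as L-algebras). Let ι : L^n → L^{2n} be the L-algebra embedding e_i ↦ f_{2i−1} + f_{2i} of standard idempotents. Then there exists a group homomorphism a : Gal(L/K) → Aut_{L-alg}(L^{2n}) such that each a_σ maps ι(L^n) onto itself, and such that for the twisted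 semilinear Gal(L/K)-action on L^{2n} given by σ * z := a_σ(σ(z)) (σ acting coordinatewise), the subring of invariants of L^{2n} is isomorphic as a K-algebra to Ω̃ via an isomorphism carrying the subring of invariants of ι(L^n) onto Ω. -/
open scoped TensorProduct

/-- The `L`-algebra embedding `ι : Lⁿ → L²ⁿ` sending the `i`-th standard idempotent `eᵢ`
to `f_{2i-1} + f_{2i}` (in 0-indexed terms, `ι(v)(j) = v(⌊j/2⌋)`). -/
def iotaFun (L : Type*) (n : ℕ) : (Fin n → L) → (Fin (2 * n) → L) :=
  fun v j => v ⟨(j : ℕ) / 2, by have := j.isLt; omega⟩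

section Split

variable {K L A B : Type*} [Field K] [Field L] [Algebra K L] [CommRing A] [Algebra K A]
  [CommRing B] [Algebra K B]

theorem exists_algHom_pi_eq_apply {F ι : Type*} [Field F] [Finite ι]
    (f : (ι → F) →ₐ[F] F) : ∃ i, ∀ z, f z = z i := by
  classical
  cases nonempty_fintype ι
  obtain ⟨i, hi⟩ : ∃ i, f (Pi.single i 1) ≠ 0 := by
    by_contra! h
    have h1 : f (∑ i, Pi.single i 1) = 1 := by
      rw [Finset.univ_sum_single (fun _ : ι => (1 : F))]
      exact map_one f
    simp [h] at h1
  refine ⟨i, fun z => mul_right_cancel₀ hi ?_⟩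
  rw [← map_mul, ← smul_eq_mul (z i), ← map_smul]
  congr 1
  ext j
  rcases eq_or_ne j i with rfl | hj <;> simp [*]

/-- The `K`-algebra homomorphism `A → L` given by a coordinate of a splitting of `A` over `L`. -/
def splittingCoord {ι : Type*} (φ : (L ⊗[K] A) ≃ₐ[L] (ι → L)) (i : ι) : A →ₐ[K] L :=
  (((Pi.evalAlgHom L (fun _ : ι => L) i).comp φ.toAlgHom).restrictScalars K).comp
    Algebra.TensorProduct.includeRight

@[simp]
theorem splittingCoord_apply {ι : Type*} (φ : (L ⊗[K] A) ≃ₐ[L] (ι → L)) (i : ι) (w : A) :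
    splittingCoord φ i w = φ (1 ⊗ₜ w) i := rfl

theorem splittingCoord_bijective {ι : Type*} [Finite ι] (φ : (L ⊗[K] A) ≃ₐ[L] (ι → L)) :
    Function.Bijective (splittingCoord φ) := by
  classical
  constructor
  · intro i j hij
    by_contra hne
    have h : (Pi.evalAlgHom L (fun _ : ι => L) i).comp φ.toAlgHom =
        (Pi.evalAlgHom L (fun _ : ι => L) j).comp φ.toAlgHom := by
      refine Algebra.TensorProduct.ext (by ext) ?_
      exact hij
    have h' := DFunLike.congr_fun h (φ.symm (Pi.single i 1))
    simp [Ne.symm hne] at h'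
  · intro t
    obtain ⟨i, hi⟩ := exists_algHom_pi_eq_apply
      ((Algebra.TensorProduct.lift (Algebra.ofId L L) t fun _ _ => Commute.all _ _).comp
        φ.symm.toAlgHom)
    refine ⟨i, AlgHom.ext fun w => ?_⟩
    rw [splittingCoord_apply, ← hi (φ (1 ⊗ₜ w))]
    simp

theorem eq_of_forall_algHom_eq {ι : Type*} (φ : (L ⊗[K] A) ≃ₐ[L] (ι → L)) {w w' : A}
    (h : ∀ t : A →ₐ[K] L, t w = t w') : w = w' := by
  refine Algebra.TensorProduct.includeRight_injective (R := K) (A := L) (B := A)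
    (algebraMap K L).injective (φ.injective ?_)
  ext i
  exact h (splittingCoord φ i)

/-- Galois descent: a Galois-equivariant function on the `L`-points of a split algebra is
evaluation at an element of the algebra. -/
theorem exists_eq_eval_of_equivariant [FiniteDimensional K L] [IsGalois K L] [Module.Finite K A]
    {ι : Type*} [Finite ι] (φ : (L ⊗[K] A) ≃ₐ[L] (ι → L)) (z : (A →ₐ[K] L) → L)
    (hz : ∀ (σ : L ≃ₐ[K] L) (t : A →ₐ[K] L), z (σ.toAlgHom.comp t) = σ (z t)) :
    ∃ w : A, ∀ t : A →ₐ[K] L, z t = t w := by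
  let b := Module.finBasis K A
  let c := (Algebra.TensorProduct.basis L b).map φ.toLinearEquiv
  have hc (k) (i) : c k i = splittingCoord φ i (b k) := by simp [c]
  let l := c.repr fun i => z (splittingCoord φ i)
  have expand (m : Fin (Module.finrank K A) → L) (i : ι) :
      (∑ k, m k • c k) i = ∑ k, m k * splittingCoord φ i (b k) := by
    simp [Finset.sum_apply, hc]
  have hl (t : A →ₐ[K] L) : z t = ∑ k, l k * t (b k) := by
    obtain ⟨i, rfl⟩ := (splittingCoord_bijective φ).2 t
    rw [← expand, c.sum_repr]
  have hfix (k) (σ : L ≃ₐ[K] L) : σ (l k) = l k := by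
    have h : ∑ k, σ (l k) • c k = ∑ k, l k • c k := by
      ext i
      rw [expand, expand, ← hl]
      have := hz σ (σ.symm.toAlgHom.comp (splittingCoord φ i))
      rw [hl (σ.symm.toAlgHom.comp _), map_sum] at this
      have hcomp : σ.toAlgHom.comp (σ.symm.toAlgHom.comp (splittingCoord φ i)) =
          splittingCoord φ i := by ext; simp
      rw [hcomp] at this
      rw [this]
      simp
    have := congrArg (fun y => (c.repr y : _ → L) k) h
    simpa only [c.repr_sum_self] using this
  have hK (k) : ∃ x : K, algebraMap K L x = l k :=
    (IsGalois.mem_range_algebraMap_iff_fixed _).2 (hfix k)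
  choose x hx using hK
  refine ⟨∑ k, x k • b k, fun t => ?_⟩
  simp [hl, map_sum, Algebra.smul_def, hx]

theorem card_fiber_comp_le_two [Finite (B →ₐ[K] L)] (g : A →ₐ[K] B) (x : B)
    (hx : ∀ b, ∃ u v, b = g u + g v * x) (s : A →ₐ[K] L) :
    Nat.card {t : B →ₐ[K] L // t.comp g = s} ≤ 2 := by
  classical
  obtain ⟨p, q, hpq⟩ := hx (x * x)
  let P : Polynomial L := Polynomial.X ^ 2 - Polynomial.C (s q) * Polynomial.X - Polynomial.C (s p)
  have hP : P.natDegree = 2 := by dsimp only [P]; compute_degree!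
  have hP0 : P ≠ 0 := by rintro h; simp [h] at hP
  have ht (t : {t : B →ₐ[K] L // t.comp g = s}) (u : A) : t.1 (g u) = s u :=
    DFunLike.congr_fun t.2 u
  have hroot (t : {t : B →ₐ[K] L // t.comp g = s}) : t.1 x ∈ P.roots.toFinset := by
    have h := congrArg t.1 hpq
    simp only [map_mul, map_add, ht] at h
    simp only [Multiset.mem_toFinset, Polynomial.mem_roots hP0, Polynomial.IsRoot.def]
    simp only [P, Polynomial.eval_sub, Polynomial.eval_pow, Polynomial.eval_mul,
      Polynomial.eval_X, Polynomial.eval_C]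
    linear_combination h
  have hinj : Function.Injective
      fun t : {t : B →ₐ[K] L // t.comp g = s} => (⟨t.1 x, hroot t⟩ : P.roots.toFinset) := by
    intro t t' h
    refine Subtype.ext (AlgHom.ext fun y => ?_)
    obtain ⟨u, v, rfl⟩ := hx y
    have h' : t.1 x = t'.1 x := congrArg Subtype.val h
    simp only [map_add, map_mul, ht, h']
  calc _ ≤ Nat.card P.roots.toFinset := Nat.card_le_card_of_injective _ hinj
    _ = P.roots.toFinset.card := Nat.card_eq_finsetCard _
    _ ≤ 2 := (Multiset.toFinset_card_le _).trans (hP ▸ P.card_roots')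

/-- If all fibers of a map from a set of `2 * n` elements to a set of `n` elements have at most two
elements, then up to labelling the map is `j ↦ ⌊j / 2⌋`. -/
theorem exists_equiv_fin_div_two {S T : Type*} {n : ℕ} (eS : Fin n ≃ S) (eT : Fin (2 * n) ≃ T)
    (π : T → S) (h : ∀ s, Nat.card {t // π t = s} ≤ 2) :
    ∃ E : T ≃ Fin (2 * n), ∀ t, (E t : ℕ) / 2 = eS.symm (π t) := by
  classical
  have := Finite.of_equiv _ eT
  have : Fintype S := Fintype.ofEquiv _ eS
  have hsum : ∑ s, Nat.card {t // π t = s} = ∑ _s : S, 2 := by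
    rw [← Nat.card_sigma, Nat.card_congr (Equiv.sigmaFiberEquiv π), ← Nat.card_congr eT]
    rw [Finset.sum_const, Finset.card_univ, ← Nat.card_eq_fintype_card, ← Nat.card_congr eS,
      Nat.card_fin, Nat.card_fin, smul_eq_mul, mul_comm]
  have heq (s : S) : Nat.card {t // π t = s} = 2 :=
    (Finset.sum_eq_sum_iff_of_le fun s _ => h s).1 hsum s (Finset.mem_univ s)
  let f (s : S) : {t // π t = s} ≃ Fin 2 := Finite.equivFinOfCardEq (heq s)
  let E : T ≃ Fin (2 * n) :=
    (Equiv.sigmaFiberEquiv π).symm.trans <| (Equiv.sigmaCongrRight f).trans <|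
    (Equiv.sigmaEquivProd S (Fin 2)).trans <| (eS.symm.prodCongr (Equiv.refl _)).trans <|
    finProdFinEquiv.trans (finCongr (mul_comm n 2))
  refine ⟨E, fun t => ?_⟩
  have : (E t : ℕ) = (f (π t) ⟨t, rfl⟩ : Fin 2) + 2 * (eS.symm (π t) : ℕ) := rfl
  rw [this]
  omega

/-- The action of `Gal(L/K)` on functions on a set identified with the `L`-points of `B`. -/
def galoisPermHom {ι : Type*} (E : (B →ₐ[K] L) ≃ ι) :
    (L ≃ₐ[K] L) →* ((ι → L) ≃ₐ[L] (ι → L)) where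
  toFun σ := AlgEquiv.ofAlgHom
    (AlgHom.pi fun j =>
      Pi.evalAlgHom L (fun _ : ι => L) (E (σ.symm.toAlgHom.comp (E.symm j))))
    (AlgHom.pi fun j =>
      Pi.evalAlgHom L (fun _ : ι => L) (E (σ.toAlgHom.comp (E.symm j))))
    (by
      ext z j
      simp only [AlgHom.comp_apply, AlgHom.pi_apply, Pi.evalAlgHom_apply, Equiv.symm_apply_apply,
        AlgHom.id_apply]
      congr 1
      rw [← E.eq_symm_apply]
      ext
      simp)
    (by
      ext z j
      simp only [AlgHom.comp_apply, AlgHom.pi_apply, Pi.evalAlgHom_apply, Equiv.symm_apply_apply,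
        AlgHom.id_apply]
      congr 1
      rw [← E.eq_symm_apply]
      ext
      simp)
  map_one' := by
    ext z j
    exact congrArg z (E.apply_symm_apply j)
  map_mul' σ τ := by
    ext z j
    change z _ = z (E (τ.symm.toAlgHom.comp (E.symm (E _))))
    rw [E.symm_apply_apply]
    rfl

theorem galoisPermHom_apply {ι : Type*} (E : (B →ₐ[K] L) ≃ ι) (σ : L ≃ₐ[K] L) (z : ι → L)
    (j : ι) : galoisPermHom E σ z j = z (E (σ.symm.toAlgHom.comp (E.symm j))) := rfl

theorem exists_twisted_form_of_generator [FiniteDimensional K L] [IsGalois K L]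
    [Module.Finite K A] [Module.Finite K B] {n : ℕ} (g : A →ₐ[K] B) (x : B)
    (hx : ∀ b, ∃ u v, b = g u + g v * x) (φ : (L ⊗[K] A) ≃ₐ[L] (Fin n → L))
    (ψ : (L ⊗[K] B) ≃ₐ[L] (Fin (2 * n) → L)) :
    ∃ (a : (L ≃ₐ[K] L) →* ((Fin (2 * n) → L) ≃ₐ[L] (Fin (2 * n) → L)))
      (R : Subalgebra K (Fin (2 * n) → L)) (e : B ≃ₐ[K] ↥R),
      (∀ σ : L ≃ₐ[K] L, (a σ) '' Set.range (iotaFun L n) = Set.range (iotaFun L n)) ∧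
      (∀ z : Fin (2 * n) → L,
        z ∈ R ↔ ∀ σ : L ≃ₐ[K] L, a σ (fun j => σ (z j)) = z) ∧
      (∀ w : B, ((e w : Fin (2 * n) → L) ∈ Set.range (iotaFun L n)) ↔ w ∈ Set.range g) := by
  let eS := Equiv.ofBijective _ (splittingCoord_bijective φ)
  let eT := Equiv.ofBijective _ (splittingCoord_bijective ψ)
  have := Finite.of_equiv _ eT
  obtain ⟨E, hE⟩ := exists_equiv_fin_div_two eS eT (fun t => t.comp g)
    (card_fiber_comp_le_two g x hx)
  have hsurj (s : A →ₐ[K] L) : ∃ t : B →ₐ[K] L, t.comp g = s := by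
    have hs := (eS.symm s).isLt
    refine ⟨E.symm ⟨2 * (eS.symm s : ℕ), by omega⟩, eS.symm.injective (Fin.ext ?_)⟩
    rw [← hE, E.apply_symm_apply]
    exact Nat.mul_div_cancel_left _ two_pos
  have hiota (v : Fin n → L) (t : B →ₐ[K] L) :
      iotaFun L n v (E t) = v (eS.symm (t.comp g)) :=
    congrArg v (Fin.ext (hE t))
  have hmaps (σ : L ≃ₐ[K] L) (v : Fin n → L) :
      galoisPermHom E σ (iotaFun L n v) ∈ Set.range (iotaFun L n) := by
    refine ⟨fun i => v (eS.symm (σ.symm.toAlgHom.comp (eS i))), funext fun j => ?_⟩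
    obtain ⟨t, rfl⟩ := E.surjective j
    rw [hiota, galoisPermHom_apply, hiota, Equiv.apply_symm_apply, E.symm_apply_apply]
    rfl
  let θ : B →ₐ[K] (Fin (2 * n) → L) := AlgHom.pi E.symm
  have hθ (w : B) (t : B →ₐ[K] L) : θ w (E t) = t w := by simp [θ]
  have hθinj : Function.Injective θ := fun w w' h =>
    eq_of_forall_algHom_eq ψ fun t => by rw [← hθ, ← hθ, h]
  refine ⟨galoisPermHom E, θ.range, AlgEquiv.ofInjective θ hθinj, fun σ => ?_, fun z => ?_,
    fun w => ?_⟩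
  · refine Set.Subset.antisymm ?_ ?_
    · rintro _ ⟨_, ⟨v, rfl⟩, rfl⟩
      exact hmaps σ v
    · rintro _ ⟨v, rfl⟩
      refine ⟨_, hmaps σ⁻¹ v, ?_⟩
      rw [← AlgEquiv.mul_apply, ← map_mul, mul_inv_cancel, map_one, AlgEquiv.one_apply]
  · constructor
    · rintro ⟨w, rfl⟩ σ
      funext j
      obtain ⟨t, rfl⟩ := E.surjective j
      rw [galoisPermHom_apply, E.symm_apply_apply]
      change σ (θ w _) = θ w _
      rw [hθ, hθ]
      simp
    · intro h
      obtain ⟨w, hw⟩ := exists_eq_eval_of_equivariant ψ (fun t => z (E t)) fun σ t => by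
        have := congrFun (h σ) (E (σ.toAlgHom.comp t))
        rw [galoisPermHom_apply, E.symm_apply_apply] at this
        rw [← this]
        congr 3
        ext
        simp
      refine ⟨w, funext fun j => ?_⟩
      obtain ⟨t, rfl⟩ := E.surjective j
      exact (hθ w t).trans (hw t).symm
  · change θ w ∈ _ ↔ _
    constructor
    · rintro ⟨v, hv⟩
      have hv' (t : B →ₐ[K] L) : v (eS.symm (t.comp g)) = t w := by
        rw [← hθ w t, ← hv, hiota]
      obtain ⟨u, hu⟩ := exists_eq_eval_of_equivariant φ (fun s => v (eS.symm s)) fun σ s => by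
        obtain ⟨t, rfl⟩ := hsurj s
        rw [hv', ← AlgHom.comp_assoc, hv']
        rfl
      exact ⟨u, eq_of_forall_algHom_eq ψ fun t => ((hu (t.comp g)).symm.trans (hv' t))⟩
    · rintro ⟨u, rfl⟩
      refine ⟨fun i => eS i u, funext fun j => ?_⟩
      obtain ⟨t, rfl⟩ := E.surjective j
      rw [hiota, hθ, eS.apply_symm_apply]
      rfl

end Split

theorem exists_generator_of_finrank_eq_two {F C : Type*} [Field F] [CommRing C] [Algebra F C]
    (h : Module.finrank F C = 2) :
    ∃ x : C, ∀ c, ∃ u v : F, c = algebraMap F C u + algebraMap F C v * x := by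
  have : Module.Finite F C := Module.finite_of_finrank_pos (by omega)
  have : Nontrivial C := Module.nontrivial_of_finrank_pos (R := F) (by omega)
  obtain ⟨x, hx⟩ : ∃ x : C, x ∉ Submodule.span F {(1 : C)} := by
    by_contra! hall
    have := finrank_le_one (R := F) (1 : C) fun w => Submodule.mem_span_singleton.1 (hall w)
    omega
  have hli : LinearIndependent F ![(1 : C), x] := by
    rw [LinearIndependent.pair_iff' one_ne_zero]
    intro a ha
    exact hx (Submodule.mem_span_singleton.2 ⟨a, ha⟩)
  have hspan := hli.span_eq_top_of_card_eq_finrank (by simp [h])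
  refine ⟨x, fun c => ?_⟩
  have hc : c ∈ Submodule.span F (Set.range ![(1 : C), x]) := hspan ▸ Submodule.mem_top
  rw [Matrix.range_cons, Matrix.range_cons, Matrix.range_empty, Set.union_empty,
    Set.singleton_union, Submodule.mem_span_pair] at hc
  obtain ⟨u, v, rfl⟩ := hc
  exact ⟨u, v, by simp [Algebra.smul_def]⟩

/-- Let `L/K` be a finite Galois extension, `Ω = L₁ × ⋯ × L_r` a finite
étale `K`-algebra of degree `n` split by `L`, and `Ω̃ = C₁ × ⋯ × C_r` a quadratic
extension of `Ω` split by `L` (each `Cᵢ` being either `Lᵢ × Lᵢ` or a separable quadratic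
field extension of `Lᵢ`). Let `ι : Lⁿ → L²ⁿ` be the `L`-algebra embedding of standard
idempotents `eᵢ ↦ f_{2i-1} + f_{2i}`. Then there is a homomorphism
`a : Gal(L/K) → Aut_{L-alg}(L²ⁿ)` such that each `a σ` maps `ι(Lⁿ)` onto itself and,
for the twisted semilinear action `σ * z = a σ (σ z)` (with `σ` acting coordinatewise),
the subring of invariants of `L²ⁿ` is `K`-isomorphic to `Ω̃` via an isomorphism carrying
the subring of invariants of `ι(Lⁿ)` onto `Ω`. -/
theorem statement_14 {K L : Type*} [Field K] [Field L] [Algebra K L]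
    [FiniteDimensional K L] [IsGalois K L] (n : ℕ) (hn : 1 ≤ n)
    (r : ℕ) (Li : Fin r → Type*) [∀ i, Field (Li i)] [∀ i, Algebra K (Li i)]
    [∀ i, FiniteDimensional K (Li i)] [∀ i, Algebra.IsSeparable K (Li i)]
    (hdeg : ∑ i, Module.finrank K (Li i) = n)
    (Ci : Fin r → Type*) [∀ i, CommRing (Ci i)] [∀ i, Algebra K (Ci i)]
    [∀ i, Algebra (Li i) (Ci i)] [∀ i, IsScalarTower K (Li i) (Ci i)]
    (hquad : ∀ i, Nonempty (Ci i ≃ₐ[Li i] (Li i × Li i)) ∨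
      (IsField (Ci i) ∧ Module.finrank (Li i) (Ci i) = 2 ∧
        Algebra.IsSeparable (Li i) (Ci i)))
    (hsplitΩ : Nonempty ((L ⊗[K] (∀ i, Li i)) ≃ₐ[L] (Fin n → L)))
    (hsplitΩt : Nonempty ((L ⊗[K] (∀ i, Ci i)) ≃ₐ[L] (Fin (2 * n) → L))) :
    ∃ (a : (L ≃ₐ[K] L) →* ((Fin (2 * n) → L) ≃ₐ[L] (Fin (2 * n) → L)))
      (R : Subalgebra K (Fin (2 * n) → L))
      (e : (∀ i, Ci i) ≃ₐ[K] ↥R),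
      (∀ σ : L ≃ₐ[K] L, (a σ) '' Set.range (iotaFun L n) = Set.range (iotaFun L n)) ∧
      (∀ z : Fin (2 * n) → L,
        z ∈ R ↔ ∀ σ : L ≃ₐ[K] L, a σ (fun j => σ (z j)) = z) ∧
      (∀ w : ∀ i, Ci i,
        ((e w : Fin (2 * n) → L) ∈ Set.range (iotaFun L n)) ↔
          w ∈ Set.range fun (u : ∀ i, Li i) (i : Fin r) =>
            algebraMap (Li i) (Ci i) (u i)) := by
  obtain ⟨φ⟩ := hsplitΩ
  obtain ⟨ψ⟩ := hsplitΩt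
  have hrank (i : Fin r) : Module.finrank (Li i) (Ci i) = 2 := by
    rcases hquad i with ⟨⟨f⟩⟩ | ⟨-, h, -⟩
    · rw [f.toLinearEquiv.finrank_eq, Module.finrank_prod, Module.finrank_self]
    · exact h
  have hfin (i : Fin r) : Module.Finite K (Ci i) := by
    have : Module.Finite (Li i) (Ci i) :=
      Module.finite_of_finrank_pos (by rw [hrank i]; exact two_pos)
    exact Module.Finite.trans (Li i) (Ci i)
  choose x hx using fun i => exists_generator_of_finrank_eq_two (hrank i)
  let g : (∀ i, Li i) →ₐ[K] (∀ i, Ci i) :=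
    AlgHom.pi fun i => (IsScalarTower.toAlgHom K (Li i) (Ci i)).comp (Pi.evalAlgHom K Li i)
  refine exists_twisted_form_of_generator g x (fun b => ?_) φ ψ
  choose u v huv using fun i => hx i (b i)
  exact ⟨u, v, funext huv⟩
end
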